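/- arXiv:2401.17854 — 9 statements merged into one kernel-verified Lean document; each statement's English description precedes it below -/
import Mathlib

section
/- Let x : ℝ → ℝ³ be a C^∞ arclength-parametrized curve, s₀ with κ > 0 and ν = √(κ'² + κ²τ²) > 0 on a neighborhood of s₀. Let e be the local inverse at 0 of ω(ε) = ∫_{s₀}^{s₀+ε} ν(s)^{1/2} ds, and set x_j = x(s₀ + e((j−3)·w)) for j = 1,…,5. Then, as w → 0 (w ≠ 0), tLast(x₁,x₂,x₃) · tFirst(x₃,x₄,x₅) = 1 − (1/8)·T²·w⁶ + O(w⁷), where T = (2κ'²τ + κ²τ³ + κκ'τ' − κκ''τ)/ν^{5/2} is evaluated at s₀. -/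
open scoped RealInnerProductSpace Topology
open Asymptotics

noncomputable section

abbrev E3 := EuclideanSpace ℝ (Fin 3)

/-- Cross product on `ℝ³`. -/
def cross3 (u v : E3) : E3 :=
  (WithLp.equiv 2 (Fin 3 → ℝ)).symm
    ![u 1 * v 2 - u 2 * v 1, u 2 * v 0 - u 0 * v 2, u 0 * v 1 - u 1 * v 0]

/-- Curvature of an arclength-parametrized curve. -/
def curv (x : ℝ → E3) (s : ℝ) : ℝ := ‖iteratedDeriv 2 x s‖

/-- Torsion of an arclength-parametrized curve (where `curv x s > 0`). -/
def tors (x : ℝ → E3) (s : ℝ) : ℝ :=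
  ⟪cross3 (deriv x s) (iteratedDeriv 2 x s), iteratedDeriv 3 x s⟫ / curv x s ^ 2

/-- `ν = √(κ'² + κ²τ²)`. -/
def nu (x : ℝ → E3) (s : ℝ) : ℝ :=
  Real.sqrt (deriv (curv x) s ^ 2 + curv x s ^ 2 * tors x s ^ 2)

/-- Oriented unit tangent vector of the circumcircle of `(a, m, b)` at `a`. -/
def tFirst (a m b : E3) : E3 :=
  (1 / dist m b) • ((dist a b / dist a m) • (m - a) + (dist a m / dist a b) • (a - b))

/-- Oriented unit tangent vector of the circumcircle of `(a, m, b)` at `m`. -/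
def tMid (a m b : E3) : E3 :=
  (1 / dist a b) • ((dist a m / dist m b) • (b - m) + (dist m b / dist a m) • (m - a))

/-- Oriented unit tangent vector of the circumcircle of `(a, m, b)` at `b`. -/
def tLast (a m b : E3) : E3 :=
  (1 / dist a m) • ((dist m b / dist a b) • (a - b) + (dist a b / dist m b) • (b - m))

/-- Taylor's theorem at an interior point, with a big-O remainder. -/
theorem ContDiffAt.isBigO_sub_taylor {E : Type*} [NormedAddCommGroup E] [NormedSpace ℝ E]
    {f : ℝ → E} {x₀ : ℝ} {n : ℕ} (hf : ContDiffAt ℝ (n + 1 : ℕ) f x₀) :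
    (fun h : ℝ => f (x₀ + h) -
        ∑ k ∈ Finset.range (n + 1), (h ^ k / k.factorial) • iteratedDeriv k f x₀)
      =O[𝓝 0] fun h => h ^ (n + 1) := by
  obtain ⟨u, hu, hfu⟩ := hf.contDiffOn le_rfl (by simp)
  obtain ⟨r, hr, hru⟩ := Metric.mem_nhds_iff.1 hu
  have hball : Metric.ball x₀ r ∈ 𝓝 x₀ := Metric.ball_mem_nhds x₀ hr
  have key := taylor_isLittleO (convex_ball x₀ r) (Metric.mem_ball_self hr) (hfu.mono hru)
  rw [nhdsWithin_eq_nhds.2 hball] at key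
  have hshift : Filter.Tendsto (fun h : ℝ => x₀ + h) (𝓝 0) (𝓝 x₀) := by
    have : ContinuousAt (fun h : ℝ => x₀ + h) 0 := by fun_prop
    simpa [ContinuousAt] using this
  have key' := (key.comp_tendsto hshift).isBigO
  have hlast : (fun h : ℝ => (h ^ (n + 1) / (n + 1).factorial) • iteratedDeriv (n + 1) f x₀)
      =O[𝓝 0] fun h => h ^ (n + 1) := by
    have : (fun h : ℝ => (h ^ (n + 1) / (n + 1).factorial) • iteratedDeriv (n + 1) f x₀)
        = fun h => h ^ (n + 1) •
            (((n + 1).factorial : ℝ)⁻¹ • iteratedDeriv (n + 1) f x₀) := by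
      funext h; rw [div_eq_mul_inv, mul_smul]
    rw [this]
    simpa using (isBigO_refl (fun h : ℝ => h ^ (n + 1)) (𝓝 0)).smul
      (isBigO_const_const (((n + 1).factorial : ℝ)⁻¹ • iteratedDeriv (n + 1) f x₀)
        (one_ne_zero (α := ℝ)) (𝓝 (0 : ℝ)))
  refine ((key'.congr_right (g₂ := fun h => h ^ (n + 1)) (by simp)).add hlast).congr_left
    fun h => ?_
  have hder : ∀ k, iteratedDerivWithin k f (Metric.ball x₀ r) x₀ = iteratedDeriv k f x₀ :=
    fun k => iteratedDerivWithin_of_isOpen Metric.isOpen_ball (Metric.mem_ball_self hr)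
  simp only [Function.comp, taylor_within_apply, hder, add_sub_cancel_left]
  rw [Finset.sum_range_succ _ (n + 1)]
  simp only [div_eq_inv_mul]
  abel

/-- A continuous function is bounded near any point. -/
theorem Continuous.isBigO_one_nhdsNE {F : Type*} [NormedAddCommGroup F] {u : ℝ → F}
    (hu : Continuous u) (t : ℝ) : u =O[𝓝[≠] t] (fun _ => (1 : ℝ)) :=
  (hu.tendsto t |>.mono_left nhdsWithin_le_nhds).isBigO_one ℝ

section Inversion

variable {E : Type*} [NormedAddCommGroup E] [InnerProductSpace ℝ E]

/-- Expansion of `h • ι (f h)`, with `ι y = ‖y‖⁻² • y` the inversion, for a curve `f` through the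
origin whose Taylor coefficients satisfy the relations of an arclength parametrization. -/
theorem isBigO_inversion_sub {f : ℝ → E} {a b c d : E}
    (hf : (fun h : ℝ => f h - (h • a + (h ^ 2 / 2) • b + (h ^ 3 / 6) • c + (h ^ 4 / 24) • d))
      =O[𝓝[≠] 0] fun h => h ^ 5)
    (ha : ‖a‖ = 1) (hab : ⟪a, b⟫ = 0) (hac : ⟪a, c⟫ = -⟪b, b⟫) (had : ⟪a, d⟫ = -3 * ⟪b, c⟫) :
    (fun h : ℝ => (h / ‖f h‖ ^ 2) • f h -
        (a + h • ((1 / 2 : ℝ) • b) + h ^ 2 • ((1 / 6 : ℝ) • c + (⟪b, b⟫ / 12) • a) +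
          h ^ 3 • ((1 / 24 : ℝ) • d + (⟪b, b⟫ / 24) • b + (⟪b, c⟫ / 12) • a)))
      =O[𝓝[≠] 0] fun h => h ^ 4 := by
  set B := ⟪b, b⟫
  set M := ⟪b, c⟫
  set q : ℝ → E := fun h => a + (h / 2) • b + (h ^ 2 / 6) • c + (h ^ 3 / 24) • d with hq
  set g : ℝ → E := fun h => h⁻¹ • f h with hg
  set ζ : ℝ → E := fun h => a + h • ((1 / 2 : ℝ) • b) + h ^ 2 • ((1 / 6 : ℝ) • c + (B / 12) • a) +
          h ^ 3 • ((1 / 24 : ℝ) • d + (B / 24) • b + (M / 12) • a) with hζ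
  have hne : ∀ᶠ h : ℝ in 𝓝[≠] 0, h ≠ 0 := eventually_mem_nhdsWithin
  have hr : (fun h => g h - q h) =O[𝓝[≠] 0] fun h => h ^ 4 := by
    refine ((isBigO_refl (fun h : ℝ => h⁻¹) (𝓝[≠] 0)).smul hf).congr' ?_ ?_
    · filter_upwards [hne] with h hh
      simp only [hg, hq, smul_sub, smul_add, smul_smul]
      congr 1
      have e1 : h⁻¹ * h = 1 := inv_mul_cancel₀ hh
      have e2 : h⁻¹ * (h ^ 2 / 2) = h / 2 := by field_simp
      have e3 : h⁻¹ * (h ^ 3 / 6) = h ^ 2 / 6 := by field_simp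
      have e4 : h⁻¹ * (h ^ 4 / 24) = h ^ 3 / 24 := by field_simp
      rw [e1, e2, e3, e4, one_smul]
    · filter_upwards [hne] with h hh
      simp only [smul_eq_mul]
      field_simp
  have hqc : Continuous q := by fun_prop
  have hζc : Continuous ζ := by fun_prop
  have hsmall : (fun h : ℝ => h ^ 4) =O[𝓝[≠] 0] fun _ => (1 : ℝ) :=
    Continuous.isBigO_one_nhdsNE (by fun_prop) 0
  have hnorm : (fun h => ‖g h‖ ^ 2 - ‖q h‖ ^ 2) =O[𝓝[≠] 0] fun h => h ^ 4 := by
    have h1 : (fun h => ⟪g h - q h, (g h - q h) + (2 : ℝ) • q h⟫) =O[𝓝[≠] 0]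
        fun h => h ^ 4 := by
      have h2 : (fun h => (g h - q h) + (2 : ℝ) • q h) =O[𝓝[≠] 0] fun _ => (1 : ℝ) :=
        (hr.trans hsmall).add (Continuous.isBigO_one_nhdsNE (by fun_prop) 0)
      have := hr.norm_left.mul h2.norm_left
      simp only [mul_one] at this
      exact (IsBigO.of_bound 1 (by
        filter_upwards with h
        simpa using abs_real_inner_le_norm (g h - q h) ((g h - q h) + (2 : ℝ) • q h))).trans this
    refine h1.congr_left fun h => ?_
    simp only [inner_add_right, inner_sub_left, inner_sub_right, inner_smul_right,
      real_inner_self_eq_norm_sq, real_inner_comm (q h) (g h)]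
    ring
  have hq2 : ∀ h, ‖q h‖ ^ 2 = 1 - B / 12 * h ^ 2 - M / 12 * h ^ 3 +
      h ^ 4 * (⟪c, c⟫ / 36 + ⟪b, d⟫ / 24 + h * ⟪c, d⟫ / 72 + h ^ 2 * ⟪d, d⟫ / 576) := by
    intro h
    have haa : ⟪a, a⟫ = 1 := by rw [real_inner_self_eq_norm_sq, ha]; norm_num
    rw [← real_inner_self_eq_norm_sq]
    simp only [hq, inner_add_left, inner_add_right, inner_smul_left, inner_smul_right, hab, hac,
      had, haa, real_inner_comm a b, real_inner_comm a c, real_inner_comm a d, real_inner_comm b c,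
      real_inner_comm b d, real_inner_comm c d, RCLike.conj_to_real]
    ring
  have hmain : (fun h => q h - ‖q h‖ ^ 2 • ζ h) =O[𝓝[≠] 0] fun h => h ^ 4 := by
    set R : ℝ → E := fun h =>
      (B / 12 + h * (M / 12)) • ((1 / 6 : ℝ) • c + (B / 12) • a) + (M / 24) • b +
      (h * (B / 12) + h ^ 2 * (M / 12)) • ((1 / 24 : ℝ) • d + (B / 24) • b + (M / 12) • a) -
      (⟪c, c⟫ / 36 + ⟪b, d⟫ / 24 + h * ⟪c, d⟫ / 72 + h ^ 2 * ⟪d, d⟫ / 576) • ζ h with hR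
    have hRc : Continuous R := by fun_prop
    have := (isBigO_refl (fun h : ℝ => h ^ 4) (𝓝[≠] 0)).smul (hRc.isBigO_one_nhdsNE 0)
    refine this.congr (fun h => ?_) (fun h => by simp)
    rw [hq2]
    simp only [hR, hq, hζ]
    module
  have hnum : (fun h => g h - ‖g h‖ ^ 2 • ζ h) =O[𝓝[≠] 0] fun h => h ^ 4 := by
    have h3 := hnorm.smul (hζc.isBigO_one_nhdsNE 0)
    refine ((hr.add hmain).sub (h3.congr_right fun h => by simp)).congr_left fun h => ?_
    module
  have hlim : Filter.Tendsto g (𝓝[≠] 0) (𝓝 a) := by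
    have hq0 : Filter.Tendsto q (𝓝[≠] 0) (𝓝 a) := by
      have := (hqc.tendsto 0).mono_left (nhdsWithin_le_nhds (s := {0}ᶜ))
      simpa [hq] using this
    have h0 : Filter.Tendsto (fun h : ℝ => h ^ 4) (𝓝[≠] 0) (𝓝 0) := by
      have : Continuous fun h : ℝ => h ^ 4 := by fun_prop
      simpa using (this.tendsto 0).mono_left (nhdsWithin_le_nhds (s := {0}ᶜ))
    simpa using (hr.trans_tendsto h0).add hq0
  have hlim2 : Filter.Tendsto (fun h => ‖g h‖ ^ 2) (𝓝[≠] 0) (𝓝 1) := by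
    simpa [ha] using (hlim.norm.pow 2)
  have hinv : (fun h => (‖g h‖ ^ 2)⁻¹) =O[𝓝[≠] 0] fun _ => (1 : ℝ) :=
    (hlim2.inv₀ one_ne_zero).isBigO_one ℝ
  have hpos : ∀ᶠ h in 𝓝[≠] 0, ‖g h‖ ^ 2 ≠ 0 := hlim2.eventually_ne one_ne_zero
  refine (hinv.smul hnum).congr' ?_ (by simp)
  filter_upwards [hne, hpos] with h hh hgh
  have e1 : f h = h • g h := by simp [hg, smul_smul, hh]
  have e2 : ‖f h‖ ^ 2 = h ^ 2 * ‖g h‖ ^ 2 := by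
    rw [e1, norm_smul, mul_pow]; simp
  rw [e2, e1, smul_sub, inv_smul_smul₀ hgh, smul_smul (h / (h ^ 2 * ‖g h‖ ^ 2))]
  congr 2
  field_simp

/-- For a curve `Z = z₀ + z₁ w + z₂ w² + z₃ w³ + O(w⁴)`, the vectors `Z(-w) - Z(-2w)/2` and
`Z(w) - Z(2w)/2` make an angle of order `w³` governed by the part of `z₃` orthogonal to `z₀`. -/
theorem isBigO_cos_sub {Z : ℝ → E} {z₀ z₁ z₂ z₃ : E} (hz₀ : z₀ ≠ 0)
    (hZ : (fun w : ℝ => Z w - (z₀ + w • z₁ + w ^ 2 • z₂ + w ^ 3 • z₃))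
      =O[𝓝[≠] 0] fun w => w ^ 4) :
    (fun w : ℝ =>
        ⟪Z (-w) - (1 / 2 : ℝ) • Z (-2 * w), Z w - (1 / 2 : ℝ) • Z (2 * w)⟫ /
          (‖Z (-w) - (1 / 2 : ℝ) • Z (-2 * w)‖ * ‖Z w - (1 / 2 : ℝ) • Z (2 * w)‖) -
        (1 - 72 * (‖z₀‖ ^ 2 * ‖z₃‖ ^ 2 - ⟪z₀, z₃⟫ ^ 2) / ‖z₀‖ ^ 4 * w ^ 6))
      =O[𝓝[≠] 0] fun w => w ^ 7 := by
  set U : ℝ → E := fun w => Z (-w) - (1 / 2 : ℝ) • Z (-2 * w) with hU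
  set V : ℝ → E := fun w => Z w - (1 / 2 : ℝ) • Z (2 * w) with hV
  set δ : ℝ → E := fun w => (w ^ 3)⁻¹ • (V w - U w) with hδ
  have hne : ∀ᶠ h : ℝ in 𝓝[≠] 0, h ≠ 0 := eventually_mem_nhdsWithin
  have scale : ∀ k : ℝ, k ≠ 0 → (fun w : ℝ => Z (k * w) -
      (z₀ + (k * w) • z₁ + (k * w) ^ 2 • z₂ + (k * w) ^ 3 • z₃)) =O[𝓝[≠] 0] fun w => w ^ 4 := by
    intro k hk
    have ht : Filter.Tendsto (fun w : ℝ => k * w) (𝓝[≠] 0) (𝓝[≠] 0) := by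
      refine tendsto_nhdsWithin_iff.2 ⟨?_, ?_⟩
      · have : Continuous fun w : ℝ => k * w := by fun_prop
        simpa using (this.tendsto 0).mono_left (nhdsWithin_le_nhds (s := {0}ᶜ))
      · filter_upwards [hne] with w hw
        simp [hk, hw]
    refine (hZ.comp_tendsto ht).trans ?_
    refine (isBigO_const_mul_self (k ^ 4) (fun w : ℝ => w ^ 4) _).congr_left fun w => ?_
    simp [mul_pow]
  have hVexp : (fun w => V w - ((1 / 2 : ℝ) • z₀ - w ^ 2 • z₂ - w ^ 3 • ((3 : ℝ) • z₃)))
      =O[𝓝[≠] 0] fun w => w ^ 4 := by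
    refine (hZ.sub ((scale 2 two_ne_zero).const_smul_left (1 / 2 : ℝ))).congr_left fun w => ?_
    simp only [hV, Pi.smul_apply]
    module
  have hUexp : (fun w => U w - ((1 / 2 : ℝ) • z₀ - w ^ 2 • z₂ + w ^ 3 • ((3 : ℝ) • z₃)))
      =O[𝓝[≠] 0] fun w => w ^ 4 := by
    refine ((scale (-1) (by norm_num)).sub
      ((scale (-2) (by norm_num)).const_smul_left (1 / 2 : ℝ))).congr_left fun w => ?_
    simp only [hU, neg_one_mul, Pi.smul_apply]
    module
  have hmono : ∀ n : ℕ, (fun w : ℝ => w ^ (n + 1)) =O[𝓝[≠] 0] fun w => w := by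
    intro n
    have := (Continuous.isBigO_one_nhdsNE (u := fun w : ℝ => w ^ n) (by fun_prop) 0).mul
      (isBigO_refl (fun w : ℝ => w) (𝓝[≠] 0))
    refine this.congr (fun w => by ring) (fun w => by simp)
  have hV1 : (fun w => V w - (1 / 2 : ℝ) • z₀) =O[𝓝[≠] 0] fun w => w := by
    have h1 := (hmono 1).smul (Continuous.isBigO_one_nhdsNE
      (u := fun w : ℝ => -z₂ - w • ((3 : ℝ) • z₃)) (by fun_prop) 0)
    refine ((hVexp.trans (hmono 3)).add (h1.congr_right (g₂ := fun w => w) (by simp))).congr_left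
      fun w => ?_
    module
  have hU1 : (fun w => U w - (1 / 2 : ℝ) • z₀) =O[𝓝[≠] 0] fun w => w := by
    have h1 := (hmono 1).smul (Continuous.isBigO_one_nhdsNE
      (u := fun w : ℝ => -z₂ + w • ((3 : ℝ) • z₃)) (by fun_prop) 0)
    refine ((hUexp.trans (hmono 3)).add (h1.congr_right (g₂ := fun w => w) (by simp))).congr_left
      fun w => ?_
    module
  have hδ1 : (fun w => δ w - (-6 : ℝ) • z₃) =O[𝓝[≠] 0] fun w => w := by
    refine ((isBigO_refl (fun w : ℝ => (w ^ 3)⁻¹) (𝓝[≠] 0)).smul (hVexp.sub hUexp)).congr' ?_ ?_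
    · filter_upwards [hne] with w hw
      have : V w - ((1 / 2 : ℝ) • z₀ - w ^ 2 • z₂ - w ^ 3 • ((3 : ℝ) • z₃)) -
          (U w - ((1 / 2 : ℝ) • z₀ - w ^ 2 • z₂ + w ^ 3 • ((3 : ℝ) • z₃))) =
          (V w - U w) - w ^ 3 • ((-6 : ℝ) • z₃) := by module
      rw [this, smul_sub, smul_smul (w ^ 3)⁻¹, inv_mul_cancel₀ (pow_ne_zero 3 hw), one_smul]
    · filter_upwards [hne] with w hw
      simp only [smul_eq_mul]
      field_simp
  set p₀ : E × E × E := ((1 / 2 : ℝ) • z₀, (1 / 2 : ℝ) • z₀, (-6 : ℝ) • z₃) with hp₀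
  set p : ℝ → E × E × E := fun w => (U w, V w, δ w) with hp
  set D : E × E × E → ℝ := fun y => ‖y.1‖ * ‖y.2.1‖ * (‖y.1‖ * ‖y.2.1‖ + ⟪y.1, y.2.1⟫) with hD
  set H : E × E × E → ℝ := fun y => (⟪y.1, y.1⟫ * ⟪y.2.2, y.2.2⟫ - ⟪y.1, y.2.2⟫ ^ 2) / D y with hH
  have hhalf : (1 / 2 : ℝ) • z₀ ≠ 0 := smul_ne_zero (by norm_num) hz₀
  have hnz : 0 < ‖z₀‖ := norm_pos_iff.2 hz₀
  have hD0 : D p₀ = ‖z₀‖ ^ 4 / 8 := by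
    simp only [hD, hp₀, norm_smul, inner_smul_left, inner_smul_right, real_inner_self_eq_norm_sq,
      RCLike.conj_to_real, Real.norm_eq_abs]
    rw [abs_of_pos (by norm_num : (0 : ℝ) < 1 / 2)]
    ring
  have hDne : D p₀ ≠ 0 := by rw [hD0]; positivity
  have hH0 : H p₀ = 72 * (‖z₀‖ ^ 2 * ‖z₃‖ ^ 2 - ⟪z₀, z₃⟫ ^ 2) / ‖z₀‖ ^ 4 := by
    simp only [hH]
    rw [hD0]
    simp only [hp₀, inner_smul_left, inner_smul_right, real_inner_self_eq_norm_sq,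
      RCLike.conj_to_real]
    field_simp
    ring
  have hDd : DifferentiableAt ℝ D p₀ := by
    have n1 : DifferentiableAt ℝ (fun y : E × E × E => ‖y.1‖) p₀ :=
      DifferentiableAt.norm ℝ (by fun_prop) hhalf
    have n2 : DifferentiableAt ℝ (fun y : E × E × E => ‖y.2.1‖) p₀ :=
      DifferentiableAt.norm ℝ (by fun_prop) hhalf
    have n3 : DifferentiableAt ℝ (fun y : E × E × E => ⟪y.1, y.2.1⟫) p₀ :=
      DifferentiableAt.inner ℝ (by fun_prop) (by fun_prop)
    exact (n1.mul n2).mul ((n1.mul n2).add n3)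
  have hHd : DifferentiableAt ℝ H p₀ := by
    have n1 : DifferentiableAt ℝ (fun y : E × E × E => ⟪y.1, y.1⟫) p₀ :=
      DifferentiableAt.inner ℝ (by fun_prop) (by fun_prop)
    have n2 : DifferentiableAt ℝ (fun y : E × E × E => ⟪y.2.2, y.2.2⟫) p₀ :=
      DifferentiableAt.inner ℝ (by fun_prop) (by fun_prop)
    have n3 : DifferentiableAt ℝ (fun y : E × E × E => ⟪y.1, y.2.2⟫) p₀ :=
      DifferentiableAt.inner ℝ (by fun_prop) (by fun_prop)
    simp only [hH, div_eq_mul_inv]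
    exact ((n1.mul n2).sub (n3.pow 2)).mul (hDd.inv hDne)
  have hp1 : (fun w => p w - p₀) =O[𝓝[≠] 0] fun w => w := hU1.prod_left (hV1.prod_left hδ1)
  have hpt : Filter.Tendsto p (𝓝[≠] 0) (𝓝 p₀) := by
    have h0 : Filter.Tendsto (fun w : ℝ => w) (𝓝[≠] 0) (𝓝 0) := nhdsWithin_le_nhds
    exact tendsto_sub_nhds_zero_iff.1 (hp1.trans_tendsto h0)
  have hHO : (fun w => H (p w) - H p₀) =O[𝓝[≠] 0] fun w => w :=
    (hHd.isBigO_sub.comp_tendsto hpt).trans hp1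
  have hDev : ∀ᶠ w in 𝓝[≠] 0, D (p w) ≠ 0 :=
    (hDd.continuousAt.tendsto.comp hpt).eventually_ne hDne
  refine ((isBigO_refl (fun w : ℝ => -w ^ 6) (𝓝[≠] 0)).mul hHO).neg_right.congr' ?_ ?_
  · filter_upwards [hne, hDev] with w hw hDw
    rw [hH0]
    set K := 72 * (‖z₀‖ ^ 2 * ‖z₃‖ ^ 2 - ⟪z₀, z₃⟫ ^ 2) / ‖z₀‖ ^ 4
    have hVU : V w = U w + w ^ 3 • δ w := by
      simp [hδ, smul_smul, hw]
    simp only [hH, hp]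
    simp only [hD, hp] at hDw ⊢
    obtain ⟨h12, h3⟩ := mul_ne_zero_iff.1 hDw
    have hG : w ^ 6 * (⟪U w, U w⟫ * ⟪δ w, δ w⟫ - ⟪U w, δ w⟫ ^ 2) =
        (‖U w‖ * ‖V w‖ - ⟪U w, V w⟫) * (‖U w‖ * ‖V w‖ + ⟪U w, V w⟫) := by
      have : ‖V w‖ ^ 2 = ‖U w‖ ^ 2 + 2 * w ^ 3 * ⟪U w, δ w⟫ + w ^ 6 * ‖δ w‖ ^ 2 := by
        rw [hVU, ← real_inner_self_eq_norm_sq]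
        simp only [inner_add_left, inner_add_right, inner_smul_left, inner_smul_right,
          real_inner_self_eq_norm_sq, RCLike.conj_to_real, real_inner_comm (U w) (δ w)]
        ring
      have h4 : ⟪U w, V w⟫ = ‖U w‖ ^ 2 + w ^ 3 * ⟪U w, δ w⟫ := by
        rw [hVU, inner_add_right, inner_smul_right, real_inner_self_eq_norm_sq]
      rw [h4, real_inner_self_eq_norm_sq, real_inner_self_eq_norm_sq]
      linear_combination -‖U w‖ ^ 2 * this
    have : w ^ 6 * ((⟪U w, U w⟫ * ⟪δ w, δ w⟫ - ⟪U w, δ w⟫ ^ 2) /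
        (‖U w‖ * ‖V w‖ * (‖U w‖ * ‖V w‖ + ⟪U w, V w⟫))) =
        1 - ⟪U w, V w⟫ / (‖U w‖ * ‖V w‖) := by
      rw [← mul_div_assoc, hG, eq_sub_iff_add_eq]
      rw [mul_div_mul_right _ _ h3, ← add_div, sub_add_cancel, div_self h12]
    linear_combination -this
  · filter_upwards with w
    ring

end Inversion

/-- The reciprocal of `e(w)/w` has a cubic Taylor expansion when `e` is `C⁵` and `e'(0) ≠ 0`. -/
theorem exists_isBigO_div_sub {e : ℝ → ℝ} (he : ContDiffAt ℝ 5 e 0) (he0 : e 0 = 0)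
    (hd : deriv e 0 ≠ 0) :
    ∃ k₁ k₂ k₃ : ℝ, (fun w : ℝ => w / e w - ((deriv e 0)⁻¹ + k₁ * w + k₂ * w ^ 2 + k₃ * w ^ 3))
      =O[𝓝[≠] 0] fun w => w ^ 4 := by
  set p : ℝ → ℝ := fun w => deriv e 0 + w * (iteratedDeriv 2 e 0 / 2) +
    w ^ 2 * (iteratedDeriv 3 e 0 / 6) + w ^ 3 * (iteratedDeriv 4 e 0 / 24) with hp
  have hp0 : p 0 = deriv e 0 := by simp [hp]
  have hne : ∀ᶠ h : ℝ in 𝓝[≠] 0, h ≠ 0 := eventually_mem_nhdsWithin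
  have hpc : ContDiff ℝ 4 p := by fun_prop
  have hpinv : ContDiffAt ℝ ((3 + 1 : ℕ) : WithTop ℕ∞) (fun w => (p w)⁻¹) 0 := by
    have : ContDiffAt ℝ 4 (fun w => (p w)⁻¹) 0 := hpc.contDiffAt.inv (by rw [hp0]; exact hd)
    exact_mod_cast this
  have hr : (fun w => e w / w - p w) =O[𝓝[≠] 0] fun w => w ^ 4 := by
    have he' : ContDiffAt ℝ ((4 + 1 : ℕ) : WithTop ℕ∞) e 0 := by exact_mod_cast he
    have := he'.isBigO_sub_taylor.mono (nhdsWithin_le_nhds (s := {0}ᶜ))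
    refine ((isBigO_refl (fun h : ℝ => h⁻¹) (𝓝[≠] 0)).mul this).congr' ?_ ?_
    · filter_upwards [hne] with w hw
      simp [Finset.sum_range_succ, he0, hp, iteratedDeriv_zero, iteratedDeriv_one,
        Nat.factorial]
      field_simp
    · filter_upwards [hne] with w hw
      field_simp
  have hpt : Filter.Tendsto p (𝓝[≠] 0) (𝓝 (deriv e 0)) := by
    have := (hpc.continuous.tendsto 0).mono_left (nhdsWithin_le_nhds (s := {0}ᶜ))
    rwa [hp0] at this
  have het : Filter.Tendsto (fun w => e w / w) (𝓝[≠] 0) (𝓝 (deriv e 0)) := by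
    have h0 : Filter.Tendsto (fun h : ℝ => h ^ 4) (𝓝[≠] 0) (𝓝 0) := by
      have : Continuous fun h : ℝ => h ^ 4 := by fun_prop
      simpa using (this.tendsto 0).mono_left (nhdsWithin_le_nhds (s := {0}ᶜ))
    simpa using (hr.trans_tendsto h0).add hpt
  have hbd := ((het.inv₀ hd).isBigO_one ℝ).mul ((hpt.inv₀ hd).isBigO_one ℝ)
  have hdiff : (fun w => w / e w - (p w)⁻¹) =O[𝓝[≠] 0] fun w => w ^ 4 := by
    refine (hbd.mul hr).neg_left.congr' ?_ (by simp)
    filter_upwards [hne, het.eventually_ne hd, hpt.eventually_ne hd] with w hw h1 h2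
    have h3 : e w ≠ 0 := fun h => h1 (by simp [h])
    field_simp
    ring
  have htay := hpinv.isBigO_sub_taylor.mono (nhdsWithin_le_nhds (s := {0}ᶜ))
  refine ⟨deriv (fun w => (p w)⁻¹) 0, iteratedDeriv 2 (fun w => (p w)⁻¹) 0 / 2,
    iteratedDeriv 3 (fun w => (p w)⁻¹) 0 / 6, (hdiff.add htay).congr_left fun w => ?_⟩
  simp [Finset.sum_range_succ, iteratedDeriv_zero, iteratedDeriv_one, Nat.factorial, hp0]
  ring

/-- Reparametrization of the expansion of an inverted curve by `h = e(w)`. -/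
theorem isBigO_reparam_inversion_sub {E : Type*} [NormedAddCommGroup E] [NormedSpace ℝ E]
    {f : ℝ → E} {e : ℝ → ℝ} {ζ₀ ζ₁ ζ₂ ζ₃ : E} (he : ContDiffAt ℝ 5 e 0) (he0 : e 0 = 0)
    (hd : deriv e 0 ≠ 0)
    (hf : (fun h : ℝ => (h / ‖f h‖ ^ 2) • f h - (ζ₀ + h • ζ₁ + h ^ 2 • ζ₂ + h ^ 3 • ζ₃))
      =O[𝓝[≠] 0] fun h => h ^ 4) :
    ∃ (z₁ z₂ : E) (k : ℝ),
      (fun w : ℝ => (w / ‖f (e w)‖ ^ 2) • f (e w) -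
        ((deriv e 0)⁻¹ • ζ₀ + w • z₁ + w ^ 2 • z₂ + w ^ 3 • (k • ζ₀ +
          (iteratedDeriv 2 e 0 / 2) • ζ₂ + (deriv e 0) ^ 2 • ζ₃)))
      =O[𝓝[≠] 0] fun w => w ^ 4 := by
  obtain ⟨k₁, k₂, k₃, hk⟩ := exists_isBigO_div_sub he he0 hd
  have hne : ∀ᶠ h : ℝ in 𝓝[≠] 0, h ≠ 0 := eventually_mem_nhdsWithin
  have hder : HasDerivAt e (deriv e 0) 0 := (he.differentiableAt (by norm_num)).hasDerivAt
  have het : Filter.Tendsto e (𝓝[≠] 0) (𝓝[≠] 0) := by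
    have := hder.tendsto_nhdsNE hd
    rwa [he0] at this
  have hene : ∀ᶠ w in 𝓝[≠] 0, e w ≠ 0 := het.eventually hne
  have heO : e =O[𝓝[≠] 0] fun w => w := by
    have := hder.isBigO_sub.mono (nhdsWithin_le_nhds (s := {0}ᶜ))
    simpa [he0] using this
  have he2 : (fun w => e w - (deriv e 0 * w + iteratedDeriv 2 e 0 / 2 * w ^ 2))
      =O[𝓝[≠] 0] fun w => w ^ 3 := by
    have he' : ContDiffAt ℝ ((2 + 1 : ℕ) : WithTop ℕ∞) e 0 :=
      he.of_le (by exact_mod_cast (by norm_num : (2 + 1 : ℕ) ≤ 5))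
    refine (he'.isBigO_sub_taylor.mono (nhdsWithin_le_nhds (s := {0}ᶜ))).congr_left fun w => ?_
    simp [Finset.sum_range_succ, he0, iteratedDeriv_zero, iteratedDeriv_one, Nat.factorial]
    ring
  have hesq : (fun w => e w ^ 2 - deriv e 0 ^ 2 * w ^ 2) =O[𝓝[≠] 0] fun w => w ^ 3 := by
    have h1 : (fun w => e w - deriv e 0 * w) =O[𝓝[≠] 0] fun w => w ^ 2 := by
      have h2 : (fun w : ℝ => w ^ 3) =O[𝓝[≠] 0] fun w => w ^ 2 := by
        have := (isBigO_refl (fun w : ℝ => w ^ 2) (𝓝[≠] 0)).mul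
          (Continuous.isBigO_one_nhdsNE (u := fun w : ℝ => w) (by fun_prop) 0)
        exact this.congr (fun w => by ring) (fun w => by simp)
      refine ((he2.trans h2).add (isBigO_const_mul_self (iteratedDeriv 2 e 0 / 2)
        (fun w : ℝ => w ^ 2) _)).congr_left fun w => by ring
    have h3 := h1.mul (heO.add (isBigO_const_mul_self (deriv e 0) (fun w : ℝ => w) _))
    exact h3.congr (fun w => by ring) (fun w => by ring)
  have hrem : (fun w => (w / e w) • ((e w / ‖f (e w)‖ ^ 2) • f (e w) -
      (ζ₀ + e w • ζ₁ + e w ^ 2 • ζ₂ + e w ^ 3 • ζ₃))) =O[𝓝[≠] 0] fun w => w ^ 4 := by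
    have h1 := (isBigO_refl (fun w => w / e w) (𝓝[≠] 0)).smul (hf.comp_tendsto het)
    have h2 : (fun w => w * e w ^ 3) =O[𝓝[≠] 0] fun w => w ^ 4 :=
      ((isBigO_refl (fun w : ℝ => w) (𝓝[≠] 0)).mul (heO.pow 3)).congr_right fun w => by ring
    refine IsBigO.trans h1 (h2.congr' ?_ (by simp))
    filter_upwards [hene] with w hw
    simp only [Function.comp, smul_eq_mul]
    field_simp
  have cst : ∀ (ζ : E) {u : ℝ → ℝ}, u =O[𝓝[≠] 0] (fun w => w ^ 4) →
      (fun w => u w • ζ) =O[𝓝[≠] 0] fun w => w ^ 4 := by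
    intro ζ u hu
    refine (hu.smul (isBigO_const_const ζ (one_ne_zero (α := ℝ)) (𝓝[≠] (0 : ℝ)))).congr_right ?_
    simp
  have hw : ∀ {u : ℝ → ℝ}, u =O[𝓝[≠] 0] (fun w => w ^ 3) →
      (fun w => w * u w) =O[𝓝[≠] 0] fun w => w ^ 4 := by
    intro u hu
    exact ((isBigO_refl (fun w : ℝ => w) (𝓝[≠] 0)).mul hu).congr_right fun w => by ring
  refine ⟨k₁ • ζ₀ + ζ₁, k₂ • ζ₀ + deriv e 0 • ζ₂, k₃,
    (((hrem.add (cst ζ₀ hk)).add (cst ζ₂ (hw he2))).add (cst ζ₃ (hw hesq))).congr' ?_ (by simp)⟩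
  filter_upwards [hene] with w hew
  have e1 : (w / e w) • ((e w / ‖f (e w)‖ ^ 2) • f (e w) -
      (ζ₀ + e w • ζ₁ + e w ^ 2 • ζ₂ + e w ^ 3 • ζ₃)) =
      (w / ‖f (e w)‖ ^ 2) • f (e w) -
        ((w / e w) • ζ₀ + w • ζ₁ + (w * e w) • ζ₂ + (w * e w ^ 2) • ζ₃) := by
    have c1 : w / e w * (e w / ‖f (e w)‖ ^ 2) = w / ‖f (e w)‖ ^ 2 := by field_simp
    have c2 : w / e w * e w = w := by field_simp
    have c3 : w / e w * e w ^ 2 = w * e w := by field_simp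
    have c4 : w / e w * e w ^ 3 = w * e w ^ 2 := by field_simp
    simp only [smul_sub, smul_add, smul_smul, c1, c2, c3, c4]
  rw [e1]
  module

/-- Smoothness and the first two derivatives of a continuous local inverse of an arclength-type
integral. -/
theorem localInverse_integral_derivs {σ ω e : ℝ → ℝ} {s₀ : ℝ} (hσ : ContDiffAt ℝ 4 σ s₀)
    (hpos : σ s₀ ≠ 0) (hω : ∀ ε, ω ε = ∫ s in s₀..(s₀ + ε), σ s)
    (he0 : e 0 = 0) (hecont : ContinuousAt e 0) (hinv : ∀ᶠ w in 𝓝 (0 : ℝ), ω (e w) = w) :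
    ContDiffAt ℝ 5 e 0 ∧ deriv e 0 = (σ s₀)⁻¹ ∧
      iteratedDeriv 2 e 0 = -deriv σ s₀ / σ s₀ ^ 3 := by
  have hcont : ∀ᶠ s in 𝓝 s₀, ContinuousAt σ s :=
    (hσ.eventually (by norm_num)).mono fun s hs => hs.continuousAt
  obtain ⟨r, hr, hball⟩ := Metric.eventually_nhds_iff_ball.1 hcont
  have hcontOn : ContinuousOn σ (Metric.ball s₀ r) := fun s hs =>
    (hball s hs).continuousWithinAt
  have hωd : ∀ ε ∈ Metric.ball (0 : ℝ) r, HasDerivAt ω (σ (s₀ + ε)) ε := by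
    intro ε hε
    have hmem : s₀ + ε ∈ Metric.ball s₀ r := by simpa using hε
    have hσint : IntervalIntegrable σ MeasureTheory.volume s₀ (s₀ + ε) :=
      (hcontOn.mono ((convex_ball s₀ r).ordConnected.uIcc_subset
        (Metric.mem_ball_self hr) hmem)).intervalIntegrable
    have h1 := intervalIntegral.integral_hasDerivAt_right hσint
      (hcontOn.stronglyMeasurableAtFilter Metric.isOpen_ball _ hmem) (hball _ hmem)
    have h2 := h1.comp_const_add s₀ ε
    exact h2.congr_of_eventuallyEq (Filter.Eventually.of_forall hω)
  have hshift : ContDiffAt ℝ 4 (fun ε => σ (s₀ + ε)) 0 := by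
    have : ContDiffAt ℝ 4 σ (s₀ + 0) := by simpa using hσ
    exact this.comp (0 : ℝ) (by fun_prop : ContDiffAt ℝ 4 (fun ε : ℝ => s₀ + ε) 0)
  have hωC : ContDiffAt ℝ 5 ω 0 := by
    have : ContDiffAt ℝ ((4 : ℕ) + 1) ω 0 := by
      refine contDiffAt_succ_iff_hasFDerivAt.2
        ⟨fun ε => ContinuousLinearMap.toSpanSingleton ℝ (σ (s₀ + ε)),
          ⟨Metric.ball 0 r, Metric.ball_mem_nhds _ hr, fun ε hε => (hωd ε hε).hasFDerivAt⟩, ?_⟩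
      exact (ContinuousLinearMap.toSpanSingletonCLE (𝕜 := ℝ) (E := ℝ)).contDiff.contDiffAt.comp
        (0 : ℝ) hshift
    exact_mod_cast this
  have hω0 : ω 0 = 0 := by simp [hω]
  have hd0 : HasDerivAt ω (σ s₀) 0 := by simpa using hωd 0 (Metric.mem_ball_self hr)
  have hf' : HasFDerivAt ω
      ((ContinuousLinearEquiv.unitsEquivAut ℝ (Units.mk0 (σ s₀) hpos) : ℝ ≃L[ℝ] ℝ) :
        ℝ →L[ℝ] ℝ) 0 := by
    convert! hd0.hasFDerivAt using 1
  have het : Filter.Tendsto e (𝓝 0) (𝓝 0) := by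
    have := hecont.tendsto
    rwa [he0] at this
  have heC : ContDiffAt ℝ 5 e 0 := by
    have h1 := hωC.to_localInverse hf' (by norm_num)
    rw [hω0] at h1
    refine h1.congr_of_eventuallyEq ?_
    have h2 := (hωC.hasStrictFDerivAt' hf' (by norm_num)).eventually_left_inverse
    filter_upwards [het.eventually h2, hinv] with w hw hi
    rw [hi] at hw
    exact hw.symm
  have hderiv : ∀ᶠ w in 𝓝 (0 : ℝ), deriv e w = (σ (s₀ + e w))⁻¹ := by
    have h1 := het.eventually (Metric.ball_mem_nhds (0 : ℝ) hr)
    have h2 : ∀ᶠ w in 𝓝 (0 : ℝ), DifferentiableAt ℝ e w :=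
      (heC.eventually (by norm_num)).mono fun w hw => hw.differentiableAt (by norm_num)
    filter_upwards [h1, h2, hinv.eventually_nhds] with w hw1 hw2 hw3
    have h4 : HasDerivAt (fun w => ω (e w)) (σ (s₀ + e w) * deriv e w) w :=
      (hωd _ hw1).comp w hw2.hasDerivAt
    have h5 : HasDerivAt (fun w => ω (e w)) 1 w := (hasDerivAt_id w).congr_of_eventuallyEq hw3
    exact eq_inv_of_mul_eq_one_right (h4.unique h5)
  have hd1 : deriv e 0 = (σ s₀)⁻¹ := by simpa [he0] using hderiv.self_of_nhds
  refine ⟨heC, hd1, ?_⟩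
  rw [iteratedDeriv_succ, iteratedDeriv_one, Filter.EventuallyEq.deriv_eq hderiv]
  have hσd : HasDerivAt σ (deriv σ s₀) (s₀ + e 0) := by
    simpa [he0] using (hσ.differentiableAt (by norm_num)).hasDerivAt
  have hed : HasDerivAt (fun w => s₀ + e w) ((σ s₀)⁻¹) 0 := by
    rw [← hd1]
    exact (heC.differentiableAt (by norm_num)).hasDerivAt.const_add s₀
  have hcomp : HasDerivAt (fun w => σ (s₀ + e w)) (deriv σ s₀ * (σ s₀)⁻¹) 0 :=
    HasDerivAt.comp (h := fun w => s₀ + e w) (0 : ℝ) hσd hed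
  rw [(hcomp.fun_inv (by simpa [he0] using hpos)).deriv]
  simp only [he0, add_zero]
  field_simp

theorem inner_cross3 (u v w : E3) :
    ⟪cross3 u v, w⟫ = (u 1 * v 2 - u 2 * v 1) * w 0 + (u 2 * v 0 - u 0 * v 2) * w 1 +
      (u 0 * v 1 - u 1 * v 0) * w 2 := by
  simp [cross3, PiLp.inner_apply, Fin.sum_univ_three]
  ring

theorem inner_E3 (u v : E3) : ⟪u, v⟫ = u 0 * v 0 + u 1 * v 1 + u 2 * v 2 := by
  simp [PiLp.inner_apply, Fin.sum_univ_three]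
  ring

/-- The square of a triple product is the Gram determinant. -/
theorem inner_cross3_sq (u v w : E3) :
    ⟪cross3 u v, w⟫ ^ 2 = ⟪u, u⟫ * (⟪v, v⟫ * ⟪w, w⟫ - ⟪v, w⟫ ^ 2) -
      ⟪u, v⟫ * (⟪u, v⟫ * ⟪w, w⟫ - ⟪v, w⟫ * ⟪u, w⟫) +
      ⟪u, w⟫ * (⟪u, v⟫ * ⟪v, w⟫ - ⟪v, v⟫ * ⟪u, w⟫) := by
  simp only [inner_cross3]
  simp only [inner_E3]
  ring

/-- Expansion of a triple product `[u, p, q]` with `p`, `q` orthogonal to a unit vector `u` in the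
orthogonal frame `u, v, u × v`. -/
theorem inner_self_mul_inner_cross3 {u v p q : E3} (hu : ⟪u, u⟫ = 1) (huv : ⟪u, v⟫ = 0)
    (hup : ⟪u, p⟫ = 0) (huq : ⟪u, q⟫ = 0) :
    ⟪v, v⟫ * ⟪cross3 u p, q⟫ = ⟪v, p⟫ * ⟪cross3 u v, q⟫ - ⟪v, q⟫ * ⟪cross3 u v, p⟫ := by
  have key : (⟪u, u⟫ * ⟪v, v⟫ - ⟪u, v⟫ ^ 2) * ⟪cross3 u p, q⟫ =
      ⟪u, u⟫ * (⟪v, p⟫ * ⟪cross3 u v, q⟫ - ⟪v, q⟫ * ⟪cross3 u v, p⟫) -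
      ⟪u, v⟫ * (⟪u, p⟫ * ⟪cross3 u v, q⟫ - ⟪u, q⟫ * ⟪cross3 u v, p⟫) := by
    simp only [inner_cross3]
    simp only [inner_E3]
    ring
  rw [hu, huv, hup, huq] at key
  linear_combination key

/-- The inversion in the unit sphere centered at the origin. -/
def unitInversion (y : E3) : E3 := (1 / ‖y‖) ^ 2 • y

theorem norm_unitInversion_sub {y z : E3} (hy : y ≠ 0) (hz : z ≠ 0) :
    ‖unitInversion y - unitInversion z‖ = ‖y - z‖ / (‖y‖ * ‖z‖) := by
  rw [← dist_eq_norm, unitInversion, unitInversion, dist_div_norm_sq_smul hy hz, dist_eq_norm]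
  ring

theorem smul_div_norm_sub_eq {u v : E3} (hu : u ≠ 0) (hv : v ≠ 0) (r : ℝ) :
    (1 / r) • ((‖v‖ / ‖u‖) • u + (‖u‖ / ‖v‖) • -v) =
      (r / (‖u‖ * ‖v‖))⁻¹ • (unitInversion u - unitInversion v) := by
  have h1 : ‖u‖ ≠ 0 := norm_ne_zero_iff.2 hu
  have h2 : ‖v‖ ≠ 0 := norm_ne_zero_iff.2 hv
  have e1 : 1 / r * (‖v‖ / ‖u‖) = ‖u‖ * ‖v‖ / r * (1 / ‖u‖) ^ 2 := by field_simp
  have e2 : 1 / r * (‖u‖ / ‖v‖) = ‖u‖ * ‖v‖ / r * (1 / ‖v‖) ^ 2 := by field_simp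
  simp only [unitInversion, smul_add, smul_sub, smul_smul, smul_neg, inv_div, e1, e2]
  rw [sub_eq_add_neg]

/-- Inversion at `a` turns the circumcircle of `(a, m, b)` into a line parallel to its tangent
at `a`. -/
theorem tFirst_eq {a m b : E3} (hm : m - a ≠ 0) (hb : b - a ≠ 0) :
    tFirst a m b = ‖unitInversion (m - a) - unitInversion (b - a)‖⁻¹ •
      (unitInversion (m - a) - unitInversion (b - a)) := by
  rw [norm_unitInversion_sub hm hb, ← smul_div_norm_sub_eq hm hb, sub_sub_sub_cancel_right,
    neg_sub, tFirst, dist_comm a b, dist_comm a m, dist_eq_norm, dist_eq_norm, dist_eq_norm]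

/-- Inversion at `b` turns the circumcircle of `(a, m, b)` into a line parallel to its tangent
at `b`. -/
theorem tLast_eq {a m b : E3} (ha : a - b ≠ 0) (hm : m - b ≠ 0) :
    tLast a m b = ‖unitInversion (a - b) - unitInversion (m - b)‖⁻¹ •
      (unitInversion (a - b) - unitInversion (m - b)) := by
  rw [norm_unitInversion_sub ha hm, ← smul_div_norm_sub_eq ha hm, sub_sub_sub_cancel_right,
    neg_sub, tLast, dist_eq_norm, dist_eq_norm, dist_eq_norm]

/-- The cosine of the angle of the two circles, in terms of the curve `Z(w) = w • ι (f w)`. -/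
theorem inner_tLast_tFirst_eq {f : ℝ → E3} {p : E3} {w : ℝ} (hw : w ≠ 0)
    (h₁ : f (-2 * w) - p ≠ 0) (h₂ : f (-w) - p ≠ 0) (h₄ : f w - p ≠ 0) (h₅ : f (2 * w) - p ≠ 0)
    {Z : ℝ → E3} (hZ : ∀ w, Z w = (w / ‖f w - p‖ ^ 2) • (f w - p)) :
    ⟪tLast (f (-2 * w)) (f (-w)) p, tFirst p (f w) (f (2 * w))⟫ =
      ⟪Z (-w) - (1 / 2 : ℝ) • Z (-2 * w), Z w - (1 / 2 : ℝ) • Z (2 * w)⟫ /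
          (‖Z (-w) - (1 / 2 : ℝ) • Z (-2 * w)‖ * ‖Z w - (1 / 2 : ℝ) • Z (2 * w)‖) := by
  have hZ' : ∀ t, Z t = t • unitInversion (f t - p) := fun t => by
    rw [hZ, unitInversion, smul_smul]
    congr 1
    ring
  have e1 : Z (-w) - (1 / 2 : ℝ) • Z (-2 * w) =
      w • (unitInversion (f (-2 * w) - p) - unitInversion (f (-w) - p)) := by
    rw [hZ', hZ']
    module
  have e2 : Z w - (1 / 2 : ℝ) • Z (2 * w) =
      w • (unitInversion (f w - p) - unitInversion (f (2 * w) - p)) := by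
    rw [hZ', hZ']
    module
  rw [tLast_eq h₁ h₂, tFirst_eq h₄ h₅, e1, e2]
  simp only [norm_smul, inner_smul_left, inner_smul_right, RCLike.conj_to_real, Real.norm_eq_abs]
  set A := ‖unitInversion (f (-2 * w) - p) - unitInversion (f (-w) - p)‖
  set B := ‖unitInversion (f w - p) - unitInversion (f (2 * w) - p)‖
  have hww : |w| * A * (|w| * B) = (w * w) * (A * B) := by
    rw [← abs_mul_abs_self w]; ring
  rw [hww, ← mul_assoc w w, mul_div_mul_left _ _ (mul_ne_zero hw hw), div_eq_mul_inv, mul_inv]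
  ring

section ArclengthCurve

variable {x : ℝ → E3}

theorem hasDerivAt_iteratedDeriv (hx : ContDiff ℝ (⊤ : ℕ∞) x) (n : ℕ) (s : ℝ) :
    HasDerivAt (iteratedDeriv n x) (iteratedDeriv (n + 1) x s) s := by
  rw [iteratedDeriv_succ]
  exact ((hx.differentiable_iteratedDeriv n (by exact_mod_cast WithTop.coe_lt_top n)) s).hasDerivAt

theorem hasDerivAt_deriv (hx : ContDiff ℝ (⊤ : ℕ∞) x) (s : ℝ) :
    HasDerivAt (deriv x) (iteratedDeriv 2 x s) s := by
  simpa [iteratedDeriv_one] using hasDerivAt_iteratedDeriv hx 1 s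

/-- The relations obtained by differentiating `⟪x', x'⟫ = 1` three times. -/
theorem arclength_relations (hx : ContDiff ℝ (⊤ : ℕ∞) x) (harc : ∀ s, ‖deriv x s‖ = 1) (s : ℝ) :
    ⟪deriv x s, iteratedDeriv 2 x s⟫ = 0 ∧
      ⟪deriv x s, iteratedDeriv 3 x s⟫ = -⟪iteratedDeriv 2 x s, iteratedDeriv 2 x s⟫ ∧
      ⟪deriv x s, iteratedDeriv 4 x s⟫ = -3 * ⟪iteratedDeriv 2 x s, iteratedDeriv 3 x s⟫ := by
  have d1 := hasDerivAt_deriv hx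
  have d2 := hasDerivAt_iteratedDeriv hx 2
  have d3 := hasDerivAt_iteratedDeriv hx 3
  have r2 : ∀ t, ⟪deriv x t, iteratedDeriv 2 x t⟫ = 0 := by
    intro t
    have h := (d1 t).inner ℝ (d1 t)
    have hc : (fun t => ⟪deriv x t, deriv x t⟫) = fun _ => (1 : ℝ) := by
      funext t; rw [real_inner_self_eq_norm_sq, harc]; norm_num
    rw [hc] at h
    have := h.unique (hasDerivAt_const t (1 : ℝ))
    linarith [real_inner_comm (deriv x t) (iteratedDeriv 2 x t)]
  have r3 : ∀ t, ⟪deriv x t, iteratedDeriv 3 x t⟫ =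
      -⟪iteratedDeriv 2 x t, iteratedDeriv 2 x t⟫ := by
    intro t
    have h := (d1 t).inner ℝ (d2 t)
    rw [funext r2] at h
    have := h.unique (hasDerivAt_const t (0 : ℝ))
    linarith
  refine ⟨r2 s, r3 s, ?_⟩
  have h := (d1 s).inner ℝ (d3 s)
  rw [funext r3] at h
  have := h.unique ((d2 s).inner ℝ (d2 s)).neg
  linarith [real_inner_comm (iteratedDeriv 2 x s) (iteratedDeriv 3 x s)]

theorem hasDerivAt_curv (hx : ContDiff ℝ (⊤ : ℕ∞) x) {s : ℝ} (hκ : 0 < curv x s) :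
    HasDerivAt (curv x) (⟪iteratedDeriv 2 x s, iteratedDeriv 3 x s⟫ / curv x s) s := by
  have h := (hasDerivAt_iteratedDeriv hx 2 s).norm_sq.sqrt (pow_pos hκ 2).ne'
  have hfun : (fun t => √(‖iteratedDeriv 2 x t‖ ^ 2)) = curv x := by
    funext t; exact Real.sqrt_sq (norm_nonneg _)
  rw [hfun, Real.sqrt_sq (norm_nonneg _)] at h
  convert! h using 1
  rw [mul_div_mul_left _ _ two_ne_zero, curv]

theorem iteratedDeriv_two_curv (hx : ContDiff ℝ (⊤ : ℕ∞) x) {s : ℝ}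
    (hκ : ∀ᶠ t in 𝓝 s, 0 < curv x t) :
    iteratedDeriv 2 (curv x) s =
      (⟪iteratedDeriv 3 x s, iteratedDeriv 3 x s⟫ + ⟪iteratedDeriv 2 x s, iteratedDeriv 4 x s⟫) /
        curv x s - ⟪iteratedDeriv 2 x s, iteratedDeriv 3 x s⟫ ^ 2 / curv x s ^ 3 := by
  have hk := hκ.self_of_nhds
  have hd : deriv (curv x) =ᶠ[𝓝 s]
      fun t => ⟪iteratedDeriv 2 x t, iteratedDeriv 3 x t⟫ / curv x t :=
    hκ.mono fun t ht => (hasDerivAt_curv hx ht).deriv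
  rw [iteratedDeriv_succ, iteratedDeriv_one, hd.deriv_eq]
  have h := ((hasDerivAt_iteratedDeriv hx 2 s).inner ℝ (hasDerivAt_iteratedDeriv hx 3 s)).fun_div
    (hasDerivAt_curv hx hk) hk.ne'
  rw [h.deriv]
  field_simp
  ring

theorem hasDerivAt_inner_cross3 (hx : ContDiff ℝ (⊤ : ℕ∞) x) (s : ℝ) :
    HasDerivAt (fun t => ⟪cross3 (deriv x t) (iteratedDeriv 2 x t), iteratedDeriv 3 x t⟫)
      ⟪cross3 (deriv x s) (iteratedDeriv 2 x s), iteratedDeriv 4 x s⟫ s := by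
  have coord : ∀ {f : ℝ → E3} {f' : E3} (i : Fin 3), HasDerivAt f f' s →
      HasDerivAt (fun t => f t i) (f' i) s := fun i hf =>
    (EuclideanSpace.proj (𝕜 := ℝ) i).hasFDerivAt.comp_hasDerivAt s hf
  have a := fun i => coord i (hasDerivAt_deriv hx s)
  have b := fun i => coord i (hasDerivAt_iteratedDeriv hx 2 s)
  have c := fun i => coord i (hasDerivAt_iteratedDeriv hx 3 s)
  simp only [inner_cross3]
  convert! (((((a 1).mul (b 2)).sub ((a 2).mul (b 1))).mul (c 0)).add
    ((((a 2).mul (b 0)).sub ((a 0).mul (b 2))).mul (c 1))).add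
    ((((a 0).mul (b 1)).sub ((a 1).mul (b 0))).mul (c 2)) using 1
  simp only [Pi.mul_apply, Pi.sub_apply]
  ring

theorem deriv_tors (hx : ContDiff ℝ (⊤ : ℕ∞) x) {s : ℝ} (hκ : 0 < curv x s) :
    deriv (tors x) s =
      ⟪cross3 (deriv x s) (iteratedDeriv 2 x s), iteratedDeriv 4 x s⟫ / curv x s ^ 2 -
        2 * ⟪cross3 (deriv x s) (iteratedDeriv 2 x s), iteratedDeriv 3 x s⟫ *
          ⟪iteratedDeriv 2 x s, iteratedDeriv 3 x s⟫ / curv x s ^ 4 := by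
  have h := (hasDerivAt_inner_cross3 hx s).fun_div ((hasDerivAt_curv hx hκ).fun_pow 2)
    (pow_pos hκ 2).ne'
  have hfun : tors x = fun t =>
      ⟪cross3 (deriv x t) (iteratedDeriv 2 x t), iteratedDeriv 3 x t⟫ / curv x t ^ 2 := rfl
  rw [hfun, h.deriv]
  field_simp
  ring

theorem curv_sq_add_eq (hx : ContDiff ℝ (⊤ : ℕ∞) x) (harc : ∀ s, ‖deriv x s‖ = 1) {s : ℝ}
    (hκ : 0 < curv x s) :
    deriv (curv x) s ^ 2 + curv x s ^ 2 * tors x s ^ 2 =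
      ⟪iteratedDeriv 3 x s, iteratedDeriv 3 x s⟫ -
        ⟪iteratedDeriv 2 x s, iteratedDeriv 2 x s⟫ ^ 2 := by
  obtain ⟨hab, hac, -⟩ := arclength_relations hx harc s
  have haa : ⟪deriv x s, deriv x s⟫ = 1 := by rw [real_inner_self_eq_norm_sq, harc]; norm_num
  have hg := inner_cross3_sq (deriv x s) (iteratedDeriv 2 x s) (iteratedDeriv 3 x s)
  have hB : ⟪iteratedDeriv 2 x s, iteratedDeriv 2 x s⟫ = curv x s ^ 2 :=
    real_inner_self_eq_norm_sq _
  rw [(hasDerivAt_curv hx hκ).deriv, tors]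
  rw [hab, hac, haa, hB] at hg
  rw [hB]
  field_simp
  linear_combination hg

theorem nu_eq_sqrt (hx : ContDiff ℝ (⊤ : ℕ∞) x) (harc : ∀ s, ‖deriv x s‖ = 1) {s : ℝ}
    (hκ : 0 < curv x s) :
    nu x s = √(⟪iteratedDeriv 3 x s, iteratedDeriv 3 x s⟫ -
        ⟪iteratedDeriv 2 x s, iteratedDeriv 2 x s⟫ ^ 2) := by
  rw [nu, curv_sq_add_eq hx harc hκ]

theorem nu_sq (hx : ContDiff ℝ (⊤ : ℕ∞) x) (harc : ∀ s, ‖deriv x s‖ = 1) {s : ℝ}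
    (hκ : 0 < curv x s) :
    nu x s ^ 2 = ⟪iteratedDeriv 3 x s, iteratedDeriv 3 x s⟫ -
        ⟪iteratedDeriv 2 x s, iteratedDeriv 2 x s⟫ ^ 2 := by
  rw [nu, Real.sq_sqrt (by positivity), curv_sq_add_eq hx harc hκ]

theorem contDiffAt_nu (hx : ContDiff ℝ (⊤ : ℕ∞) x) (harc : ∀ s, ‖deriv x s‖ = 1) {s : ℝ}
    (hκ : ∀ᶠ t in 𝓝 s, 0 < curv x t) (hν : 0 < nu x s) (n : ℕ) : ContDiffAt ℝ n (nu x) s := by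
  have hc : ∀ k : ℕ, ContDiffAt ℝ n (iteratedDeriv k x) s := fun k => by
    rw [iteratedDeriv_eq_iterate]
    exact (ContDiff.iterate_deriv' n k (hx.of_le (by exact_mod_cast le_top))).contDiffAt
  have hpos := pow_pos hν 2
  rw [nu_sq hx harc hκ.self_of_nhds] at hpos
  have h : ContDiffAt ℝ n (fun t => √(⟪iteratedDeriv 3 x t, iteratedDeriv 3 x t⟫ -
        ⟪iteratedDeriv 2 x t, iteratedDeriv 2 x t⟫ ^ 2)) s :=
    (((hc 3).inner ℝ (hc 3)).sub (((hc 2).inner ℝ (hc 2)).pow 2)).sqrt hpos.ne'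
  exact h.congr_of_eventuallyEq (hκ.mono fun t ht => nu_eq_sqrt hx harc ht)

theorem nu_mul_deriv_nu (hx : ContDiff ℝ (⊤ : ℕ∞) x) (harc : ∀ s, ‖deriv x s‖ = 1) {s : ℝ}
    (hκ : ∀ᶠ t in 𝓝 s, 0 < curv x t) (hν : 0 < nu x s) :
    nu x s * deriv (nu x) s = ⟪iteratedDeriv 3 x s, iteratedDeriv 4 x s⟫ -
      2 * ⟪iteratedDeriv 2 x s, iteratedDeriv 2 x s⟫ *
        ⟪iteratedDeriv 2 x s, iteratedDeriv 3 x s⟫ := by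
  have h1 := ((contDiffAt_nu hx harc hκ hν 1).differentiableAt (by norm_num)).hasDerivAt.fun_pow 2
  have d2 := hasDerivAt_iteratedDeriv hx 2 s
  have d3 := hasDerivAt_iteratedDeriv hx 3 s
  have h2 := (d3.inner ℝ d3).sub ((d2.inner ℝ d2).fun_pow 2)
  have h3 := h1.unique (h2.congr_of_eventuallyEq (hκ.mono fun t ht => nu_sq hx harc ht))
  norm_num at h3
  rw [← real_inner_self_eq_norm_sq, real_inner_comm (iteratedDeriv 3 x s),
    real_inner_comm (iteratedDeriv 2 x s) (iteratedDeriv 3 x s)] at h3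
  linear_combination h3 / 2

end ArclengthCurve

/-- The conformal torsion numerator as a determinant of the components of `x'''` and `x''''`. -/
theorem conformalTorsion_numerator_eq {x : ℝ → E3} (hx : ContDiff ℝ (⊤ : ℕ∞) x)
    (harc : ∀ s, ‖deriv x s‖ = 1) {s : ℝ} (hκ : ∀ᶠ t in 𝓝 s, 0 < curv x t) {P Q : E3}
    (hP : P = iteratedDeriv 3 x s + ⟪iteratedDeriv 2 x s, iteratedDeriv 2 x s⟫ • deriv x s)
    (hQ : Q = iteratedDeriv 4 x s + (3 * ⟪iteratedDeriv 2 x s, iteratedDeriv 3 x s⟫) • deriv x s +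
      ⟪iteratedDeriv 2 x s, iteratedDeriv 2 x s⟫ • iteratedDeriv 2 x s) :
    2 * deriv (curv x) s ^ 2 * tors x s + curv x s ^ 2 * tors x s ^ 3 +
        curv x s * deriv (curv x) s * deriv (tors x) s -
        curv x s * iteratedDeriv 2 (curv x) s * tors x s = ⟪cross3 (deriv x s) P, Q⟫ := by
  obtain ⟨hab, hac, had⟩ := arclength_relations hx harc s
  have hk := hκ.self_of_nhds
  have haa : ⟪deriv x s, deriv x s⟫ = 1 := by rw [real_inner_self_eq_norm_sq, harc]; norm_num
  have hg := inner_cross3_sq (deriv x s) (iteratedDeriv 2 x s) (iteratedDeriv 3 x s)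
  rw [iteratedDeriv_two_curv hx hκ, deriv_tors hx hk, (hasDerivAt_curv hx hk).deriv, tors]
  have hB : ⟪iteratedDeriv 2 x s, iteratedDeriv 2 x s⟫ = curv x s ^ 2 :=
    real_inner_self_eq_norm_sq _
  rw [hab, hac, haa] at hg
  generalize curv x s = κ at *
  generalize deriv x s = a at *
  generalize iteratedDeriv 2 x s = b at *
  generalize iteratedDeriv 3 x s = c at *
  generalize iteratedDeriv 4 x s = d at *
  have hdet : ∀ (q : E3) (r t : ℝ), ⟪cross3 a b, q + r • a + t • b⟫ = ⟪cross3 a b, q⟫ := by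
    intro q r t
    simp only [inner_cross3, PiLp.add_apply, PiLp.smul_apply, smul_eq_mul]
    ring
  have hba : ⟪b, a⟫ = 0 := by rw [real_inner_comm, hab]
  have hkey := inner_self_mul_inner_cross3 (u := a) (v := b) (p := P) (q := Q) haa hab
    (by rw [hP, inner_add_right, inner_smul_right, hac, haa]; ring)
    (by
      rw [hQ, inner_add_right, inner_add_right, inner_smul_right, inner_smul_right, had, haa, hab]
      ring)
  have h1 : ⟪cross3 a b, Q⟫ = ⟪cross3 a b, d⟫ := by rw [hQ, hdet]
  have h2 : ⟪cross3 a b, P⟫ = ⟪cross3 a b, c⟫ := by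
    rw [hP]; simpa using hdet c ⟪b, b⟫ 0
  have h3 : ⟪b, P⟫ = ⟪b, c⟫ := by rw [hP, inner_add_right, inner_smul_right, hba]; ring
  have h4 : ⟪b, Q⟫ = ⟪b, d⟫ + ⟪b, b⟫ ^ 2 := by
    rw [hQ, inner_add_right, inner_add_right, inner_smul_right, inner_smul_right, hba]; ring
  rw [h1, h2, h3, h4, hB] at hkey
  rw [hB] at hg
  refine mul_left_cancel₀ (pow_pos hk 2).ne' ?_
  rw [hkey]
  field_simp
  linear_combination ⟪cross3 a b, c⟫ * hg

/-- The Gram determinant of `r • a` and `k • a + m • P + n • Q` for `P, Q` orthogonal to the unit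
vector `a`. -/
theorem gram_smul_add_eq {a P Q : E3} (haa : ⟪a, a⟫ = 1) (haP : ⟪a, P⟫ = 0) (haQ : ⟪a, Q⟫ = 0)
    (r k m n : ℝ) :
    ‖r • a‖ ^ 2 * ‖k • a + m • P + n • Q‖ ^ 2 - ⟪r • a, k • a + m • P + n • Q⟫ ^ 2 =
      r ^ 2 * (m ^ 2 * ⟪P, P⟫ + 2 * m * n * ⟪P, Q⟫ + n ^ 2 * ⟪Q, Q⟫) := by
  have hPa : ⟪P, a⟫ = 0 := by rw [real_inner_comm, haP]
  have hQa : ⟪Q, a⟫ = 0 := by rw [real_inner_comm, haQ]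
  simp only [← real_inner_self_eq_norm_sq, inner_add_left, inner_add_right, real_inner_smul_left,
    real_inner_smul_right, haa, haP, haQ, hPa, hQa, real_inner_comm P Q]
  ring

/-- The leading coefficient of the cosine expansion is the square of the conformal torsion. -/
theorem cos_coefficient_eq {x : ℝ → E3} (hx : ContDiff ℝ (⊤ : ℕ∞) x)
    (harc : ∀ s, ‖deriv x s‖ = 1) {s : ℝ} (hκ : ∀ᶠ t in 𝓝 s, 0 < curv x t) (hν : 0 < nu x s)
    {a b c d z₀ z₃ : E3} (ha : a = deriv x s) (hb : b = iteratedDeriv 2 x s)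
    (hc : c = iteratedDeriv 3 x s) (hd : d = iteratedDeriv 4 x s) {k : ℝ}
    (hz₀ : z₀ = √(nu x s) • a)
    (hz₃ : z₃ = k • a +
      (-deriv (nu x) s / (4 * nu x s ^ 2)) • ((1 / 6 : ℝ) • c + (⟪b, b⟫ / 12) • a) +
      (nu x s)⁻¹ • ((1 / 24 : ℝ) • d + (⟪b, b⟫ / 24) • b + (⟪b, c⟫ / 12) • a)) :
    72 * (‖z₀‖ ^ 2 * ‖z₃‖ ^ 2 - ⟪z₀, z₃⟫ ^ 2) / ‖z₀‖ ^ 4 =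
      1 / 8 * ((2 * deriv (curv x) s ^ 2 * tors x s + curv x s ^ 2 * tors x s ^ 3 +
          curv x s * deriv (curv x) s * deriv (tors x) s -
          curv x s * iteratedDeriv 2 (curv x) s * tors x s) / nu x s ^ ((5 : ℝ) / 2)) ^ 2 := by
  have hN := conformalTorsion_numerator_eq hx harc hκ rfl rfl
  obtain ⟨hab, hac, had⟩ := arclength_relations hx harc s
  have haa : ⟪deriv x s, deriv x s⟫ = 1 := by rw [real_inner_self_eq_norm_sq, harc]; norm_num
  have hν2 := nu_sq hx harc hκ.self_of_nhds
  have hνν := nu_mul_deriv_nu hx harc hκ hν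
  rw [hN, div_pow, ← Real.rpow_natCast (nu x s ^ ((5 : ℝ) / 2)), ← Real.rpow_mul hν.le,
    show (5 : ℝ) / 2 * (2 : ℕ) = (5 : ℕ) by norm_num, Real.rpow_natCast]
  rw [← ha, ← hb, ← hc, ← hd] at *
  clear hN
  set P := c + ⟪b, b⟫ • a with hP
  set Q := d + (3 * ⟪b, c⟫) • a + ⟪b, b⟫ • b with hQ
  have hca : ⟪c, a⟫ = -⟪b, b⟫ := by rw [real_inner_comm, hac]
  have haP : ⟪a, P⟫ = 0 := by rw [hP, inner_add_right, inner_smul_right, hac, haa]; ring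
  have haQ : ⟪a, Q⟫ = 0 := by
    rw [hQ, inner_add_right, inner_add_right, inner_smul_right, inner_smul_right, had, haa, hab]
    ring
  have hPP : ⟪P, P⟫ = nu x s ^ 2 := by
    rw [hν2, hP, inner_add_left, inner_add_right, inner_add_right, real_inner_smul_left,
      real_inner_smul_right, real_inner_smul_left, real_inner_smul_right, hac, hca, haa]
    ring
  have hPQ : ⟪P, Q⟫ = nu x s * deriv (nu x) s := by
    nth_rw 1 [hP]
    rw [hνν, inner_add_left, real_inner_smul_left, haQ, hQ, inner_add_right, inner_add_right,
      real_inner_smul_right, real_inner_smul_right, hca, real_inner_comm b c]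
    ring
  have hz : z₃ = (k + deriv (nu x) s / (4 * nu x s ^ 2) * (⟪b, b⟫ / 12) -
        (nu x s)⁻¹ * (⟪b, c⟫ / 24)) • a +
      (-deriv (nu x) s / (24 * nu x s ^ 2)) • P + (1 / (24 * nu x s)) • Q := by
    rw [hz₃, hP, hQ]
    module
  have hg := inner_cross3_sq a P Q
  rw [haa, haP, haQ, hPP, hPQ] at hg
  have hz₀n : ‖z₀‖ ^ 2 = nu x s := by
    rw [hz₀, norm_smul, mul_pow, ← real_inner_self_eq_norm_sq a, haa, Real.norm_eq_abs, sq_abs,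
      Real.sq_sqrt hν.le, mul_one]
  have hgram := gram_smul_add_eq haa haP haQ (√(nu x s))
    (k + deriv (nu x) s / (4 * nu x s ^ 2) * (⟪b, b⟫ / 12) - (nu x s)⁻¹ * (⟪b, c⟫ / 24))
    (-deriv (nu x) s / (24 * nu x s ^ 2)) (1 / (24 * nu x s))
  rw [← hz₀, ← hz, hPP, hPQ, Real.sq_sqrt hν.le] at hgram
  rw [hgram, hg, show ‖z₀‖ ^ 4 = (‖z₀‖ ^ 2) ^ 2 by ring, hz₀n]
  field_simp
  ring

theorem statement8 (x : ℝ → E3) (hx : ContDiff ℝ (⊤ : ℕ∞) x)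
    (harc : ∀ s, ‖deriv x s‖ = 1) (s₀ : ℝ)
    (hκ : ∀ᶠ s in 𝓝 s₀, 0 < curv x s) (hν : ∀ᶠ s in 𝓝 s₀, 0 < nu x s)
    -- conformal length function and its local inverse `e` at `0`
    (ω e : ℝ → ℝ) (hω : ∀ ε, ω ε = ∫ s in s₀..(s₀ + ε), Real.sqrt (nu x s))
    (he0 : e 0 = 0) (hecont : ContinuousAt e 0)
    (hinv : ∀ᶠ w in 𝓝 (0 : ℝ), ω (e w) = w)
    -- `T` is the conformal torsion at `s₀`
    (T : ℝ)
    (hT : T = (2 * deriv (curv x) s₀ ^ 2 * tors x s₀ + curv x s₀ ^ 2 * tors x s₀ ^ 3 +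
          curv x s₀ * deriv (curv x) s₀ * deriv (tors x) s₀ -
          curv x s₀ * iteratedDeriv 2 (curv x) s₀ * tors x s₀) /
        nu x s₀ ^ ((5 : ℝ) / 2)) :
    (fun w : ℝ =>
        ⟪tLast (x (s₀ + e (-2 * w))) (x (s₀ + e (-w))) (x s₀),
            tFirst (x s₀) (x (s₀ + e w)) (x (s₀ + e (2 * w)))⟫ -
          (1 - 1 / 8 * T ^ 2 * w ^ 6))
      =O[𝓝[≠] (0 : ℝ)] fun w => w ^ 7 := by
  have hν₀ := hν.self_of_nhds
  obtain ⟨hab, hac, had⟩ := arclength_relations hx harc s₀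
  have hσ : ContDiffAt ℝ 4 (fun s => √(nu x s)) s₀ :=
    (contDiffAt_nu hx harc hκ hν₀ 4).sqrt hν₀.ne'
  have hσ' : deriv (fun s => √(nu x s)) s₀ = deriv (nu x) s₀ / (2 * √(nu x s₀)) :=
    ((((contDiffAt_nu hx harc hκ hν₀ 1).differentiableAt (by norm_num)).hasDerivAt).sqrt
      hν₀.ne').deriv
  have hsq : 0 < √(nu x s₀) := Real.sqrt_pos.2 hν₀
  obtain ⟨heC, he1, he2⟩ := localInverse_integral_derivs hσ hsq.ne' hω he0 hecont hinv
  have hd : deriv e 0 ≠ 0 := by rw [he1]; exact inv_ne_zero hsq.ne'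
  have htaylor := (ContDiffAt.isBigO_sub_taylor (n := 4) (x₀ := s₀)
    (hx.of_le (by norm_cast)).contDiffAt).mono (nhdsWithin_le_nhds (s := {(0 : ℝ)}ᶜ))
  have hf : (fun h => (x (s₀ + h) - x s₀) - (h • deriv x s₀ + (h ^ 2 / 2) • iteratedDeriv 2 x s₀ +
      (h ^ 3 / 6) • iteratedDeriv 3 x s₀ + (h ^ 4 / 24) • iteratedDeriv 4 x s₀))
      =O[𝓝[≠] 0] fun h => h ^ 5 := by
    refine htaylor.congr_left fun h => ?_
    simp only [Finset.sum_range_succ, Finset.sum_range_zero, iteratedDeriv_zero, iteratedDeriv_one,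
      Nat.factorial]
    norm_num
    module
  obtain ⟨z₁, z₂, k, hZ⟩ := isBigO_reparam_inversion_sub (f := fun h => x (s₀ + h) - x s₀)
    heC he0 hd (isBigO_inversion_sub hf (harc s₀) hab hac had)
  have hz₀ : (deriv e 0)⁻¹ • deriv x s₀ ≠ 0 :=
    smul_ne_zero (inv_ne_zero hd) (norm_ne_zero_iff.1 (by rw [harc]; exact one_ne_zero))
  have hcos := isBigO_cos_sub hz₀ hZ
  have hne : ∀ᶠ t in 𝓝[≠] (0 : ℝ), x (s₀ + e t) - x s₀ ≠ 0 := by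
    have h1 : HasDerivAt e (deriv e 0) 0 := (heC.differentiableAt (by norm_num)).hasDerivAt
    have h2 : HasDerivAt x (deriv x s₀) (s₀ + e 0) := by
      rw [he0, add_zero]
      exact (hx.differentiable (by norm_num) s₀).hasDerivAt
    have h3 := (h2.scomp 0 (h1.const_add s₀)).eventually_ne (c := x s₀)
      (smul_ne_zero hd (smul_ne_zero_iff.1 hz₀).2)
    exact h3.mono fun t ht => sub_ne_zero.2 ht
  have hscale : ∀ r : ℝ, r ≠ 0 → ∀ᶠ w in 𝓝[≠] (0 : ℝ), x (s₀ + e (r * w)) - x s₀ ≠ 0 := by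
    intro r hr
    have ht : Filter.Tendsto (fun w : ℝ => r * w) (𝓝[≠] 0) (𝓝[≠] 0) := by
      refine tendsto_nhdsWithin_iff.2 ⟨?_, ?_⟩
      · have : Filter.Tendsto (fun w : ℝ => r * w) (𝓝 0) (𝓝 (r * 0)) :=
          (continuous_const_mul r).tendsto 0
        rw [mul_zero] at this
        exact this.mono_left nhdsWithin_le_nhds
      · filter_upwards [self_mem_nhdsWithin] with w hw using mul_ne_zero hr hw
    exact ht.eventually hne
  refine hcos.congr' ?_ Filter.EventuallyEq.rfl
  filter_upwards [self_mem_nhdsWithin, hscale (-2) (by norm_num), hscale (-1) (by norm_num), hne,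
    hscale 2 two_ne_zero] with w hw h₁ h₂ h₄ h₅
  rw [neg_one_mul] at h₂
  rw [inner_tLast_tFirst_eq (f := fun t => x (s₀ + e t)) hw h₁ h₂ h₄ h₅ fun _ => rfl]
  congr 3
  rw [hT]
  refine cos_coefficient_eq hx harc hκ hν₀ rfl rfl rfl rfl (k := k) ?_ ?_
  · rw [he1, inv_inv]
  · have hs : √(nu x s₀) ^ 2 = nu x s₀ := Real.sq_sqrt hν₀.le
    have h1 : iteratedDeriv 2 e 0 / 2 = -deriv (nu x) s₀ / (4 * nu x s₀ ^ 2) := by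
      rw [he2, hσ', ← hs]
      field_simp
      norm_num
      ring
    rw [h1, he1, inv_pow, hs]
end
end

section
/- For any three pairwise distinct points a, m, b ∈ ℝ³, the three vectors tFirst(a,m,b), tMid(a,m,b) and tLast(a,m,b) all have Euclidean norm 1. -/
open scoped RealInnerProductSpace Topology

noncomputable section

/-- Exchanging the lengths of two nonzero vectors, keeping their directions, does not change the
norm of their sum. -/
theorem norm_div_smul_add_div_smul {E : Type*} [NormedAddCommGroup E] [InnerProductSpace ℝ E]
    {u v : E} (hu : u ≠ 0) (hv : v ≠ 0) :
    ‖(‖v‖ / ‖u‖) • u + (‖u‖ / ‖v‖) • v‖ = ‖u + v‖ := by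
  have hu' : ‖u‖ ≠ 0 := norm_ne_zero_iff.mpr hu
  have hv' : ‖v‖ ≠ 0 := norm_ne_zero_iff.mpr hv
  rw [← sq_eq_sq₀ (norm_nonneg _) (norm_nonneg _), norm_add_sq_real, norm_add_sq_real,
    norm_smul, norm_smul, real_inner_smul_left, real_inner_smul_right, norm_div, norm_div,
    norm_norm, norm_norm]
  field_simp
  ring

/-- The sum of two nonzero vectors with exchanged lengths, divided by the norm of their sum, is a
unit vector. -/
theorem norm_one_div_smul_div_smul_add_div_smul {E : Type*} [NormedAddCommGroup E]
    [InnerProductSpace ℝ E] {u v : E} (hu : u ≠ 0) (hv : v ≠ 0) (huv : u + v ≠ 0) :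
    ‖(1 / ‖u + v‖) • ((‖v‖ / ‖u‖) • u + (‖u‖ / ‖v‖) • v)‖ = 1 := by
  rw [norm_smul, norm_div_smul_add_div_smul hu hv, norm_div, norm_one, norm_norm,
    one_div_mul_cancel (norm_ne_zero_iff.mpr huv)]

theorem statement9 (a m b : E3) (ham : a ≠ m) (hmb : m ≠ b) (hab : a ≠ b) :
    ‖tFirst a m b‖ = 1 ∧ ‖tMid a m b‖ = 1 ∧ ‖tLast a m b‖ = 1 := by
  have ham' := sub_ne_zero.mpr ham
  have hma' := sub_ne_zero.mpr ham.symm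
  have hmb' := sub_ne_zero.mpr hmb
  have hbm' := sub_ne_zero.mpr hmb.symm
  have hab' := sub_ne_zero.mpr hab
  have hba' := sub_ne_zero.mpr hab.symm
  refine ⟨?_, ?_, ?_⟩
  · have h := norm_one_div_smul_div_smul_add_div_smul hma' hab' (by rwa [sub_add_sub_cancel])
    rwa [sub_add_sub_cancel, ← dist_eq_norm, ← dist_eq_norm, ← dist_eq_norm, dist_comm m a] at h
  · have h := norm_one_div_smul_div_smul_add_div_smul hbm' hma' (by rwa [sub_add_sub_cancel])
    rwa [sub_add_sub_cancel, ← dist_eq_norm, ← dist_eq_norm, ← dist_eq_norm, dist_comm m a,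
      dist_comm b a, dist_comm b m] at h
  · have h := norm_one_div_smul_div_smul_add_div_smul hab' hbm' (by rwa [sub_add_sub_cancel])
    rwa [sub_add_sub_cancel, ← dist_eq_norm, ← dist_eq_norm, ← dist_eq_norm, dist_comm b m] at h
end
end

section
/- Let a, m, b ∈ ℝ³ be affinely independent (hence pairwise distinct) and let o be the circumcenter of the triangle with vertices a, m, b (the unique point in the affine plane of a, m, b equidistant from all three). Then ⟨tFirst(a,m,b), a − o⟩ = 0, ⟨tMid(a,m,b), m − o⟩ = 0 and ⟨tLast(a,m,b), b − o⟩ = 0; i.e. these vectors are tangent to the circumcircle of (a,m,b) at a, m, b respectively. -/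
open scoped RealInnerProductSpace Topology

noncomputable section

/-- If `p` and `q` are equidistant from `o`, then the chord `q - p` makes inner product
`-|p - q|² / 2` with the radius `p - o`. -/
lemma inner_chord_radius {V : Type*} [NormedAddCommGroup V] [InnerProductSpace ℝ V]
    {o p q : V} (h : dist o p = dist o q) :
    ⟪q - p, p - o⟫ = -(dist p q ^ 2 / 2) := by
  have hq : ‖(q - p) + (p - o)‖ = ‖p - o‖ := by
    rw [sub_add_sub_cancel, ← dist_eq_norm, ← dist_eq_norm, dist_comm q, dist_comm p, h]
  have hsq := norm_add_sq_real (q - p) (p - o)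
  rw [hq] at hsq
  rw [dist_comm, dist_eq_norm]
  linarith

/-- The weighted combination of the two chords at `p` is orthogonal to the radius at `p`. -/
lemma inner_weighted_chords_radius {V : Type*} [NormedAddCommGroup V] [InnerProductSpace ℝ V]
    {o p q r : V} (hq : dist o p = dist o q) (hr : dist o p = dist o r) (c : ℝ) :
    ⟪c • ((dist p r / dist p q) • (q - p) + (dist p q / dist p r) • (p - r)), p - o⟫ = 0 := by
  have hmul (u v : ℝ) : u / v * v ^ 2 = u * v := by
    rcases eq_or_ne v 0 with rfl | hv
    · simp
    · field_simp
  rw [← neg_sub r p, real_inner_smul_left, inner_add_left, real_inner_smul_left,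
    real_inner_smul_left, inner_neg_left, inner_chord_radius hq, inner_chord_radius hr]
  linear_combination c / 2 * (hmul (dist p q) (dist p r) - hmul (dist p r) (dist p q))

theorem statement10 (a m b : E3) (hind : AffineIndependent ℝ ![a, m, b])
    (o : E3) (ho : o ∈ affineSpan ℝ ({a, m, b} : Set E3))
    (hoa : dist o a = dist o m) (hob : dist o m = dist o b) :
    ⟪tFirst a m b, a - o⟫ = 0 ∧ ⟪tMid a m b, m - o⟫ = 0 ∧ ⟪tLast a m b, b - o⟫ = 0 := by
  refine ⟨inner_weighted_chords_radius hoa (hoa.trans hob) _, ?_, ?_⟩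
  · simpa only [tMid, dist_comm m a] using
      inner_weighted_chords_radius hob hoa.symm (1 / dist a b)
  · simpa only [tLast, dist_comm b m, dist_comm b a] using
      inner_weighted_chords_radius (hoa.trans hob).symm hob.symm (1 / dist a m)
end
end

section
/- For four pairwise distinct points x₁, x₂, x₃, x₄ ∈ ℝ³, the cosine of the crossing angle between the circumcircle of (x₂,x₃,x₄) and the circumcircle of (x₁,x₃,x₄) is the same at their two intersection points x₃ and x₄: tMid(x₂,x₃,x₄) · tMid(x₁,x₃,x₄) = tLast(x₂,x₃,x₄) · tLast(x₁,x₃,x₄). -/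
open scoped RealInnerProductSpace Topology

noncomputable section

/-- The tangent at `b` is the mirror image of the tangent at `m` across the direction of the
chord `b - m`. -/
theorem tLast_eq_reflection_tMid {a m b : E3} (ham : a ≠ m) (hab : a ≠ b) (hmb : m ≠ b) :
    tLast a m b = (ℝ ∙ (b - m)).reflection (tMid a m b) := by
  have hA : dist a m ≠ 0 := dist_ne_zero.2 ham
  have hB : dist a b ≠ 0 := dist_ne_zero.2 hab
  have hD : dist m b ≠ 0 := dist_ne_zero.2 hmb
  have hnorm : ‖b - m‖ = dist m b := by rw [dist_comm, dist_eq_norm]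
  have hinner : ⟪b - m, m - a⟫ = (dist a b ^ 2 - dist m b ^ 2 - dist a m ^ 2) / 2 := by
    have h := norm_add_sq_real (b - m) (m - a)
    rw [sub_add_sub_cancel, hnorm, ← dist_eq_norm, ← dist_eq_norm, dist_comm b a,
      dist_comm m a] at h
    linarith
  rw [Submodule.reflection_singleton_apply]
  simp only [tLast, tMid, inner_smul_right, inner_add_right, real_inner_self_eq_norm_sq, hinner,
    hnorm, RCLike.ofReal_real_eq_id, id_eq]
  match_scalars <;> field_simp <;> ring

theorem statement12 (x₁ x₂ x₃ x₄ : E3)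
    (h12 : x₁ ≠ x₂) (h13 : x₁ ≠ x₃) (h14 : x₁ ≠ x₄)
    (h23 : x₂ ≠ x₃) (h24 : x₂ ≠ x₄) (h34 : x₃ ≠ x₄) :
    ⟪tMid x₂ x₃ x₄, tMid x₁ x₃ x₄⟫ = ⟪tLast x₂ x₃ x₄, tLast x₁ x₃ x₄⟫ := by
  rw [tLast_eq_reflection_tMid h23 h24 h34, tLast_eq_reflection_tMid h13 h14 h34,
    LinearIsometryEquiv.inner_map_map]
end
end

section
/- For four pairwise distinct points x₁, x₂, x₃, x₄ ∈ ℝ³ with cross ratios u = (x₁₂·x₃₄)/(x₁₃·x₂₄) and v = (x₁₄·x₂₃)/(x₁₃·x₂₄), the cosine of the crossing angle at x₃ between the circumcircle of (x₂,x₃,x₄) and the circumcircle of (x₁,x₃,x₄) equals p = (1 + v² − u²)/(2v); that is, tMid(x₂,x₃,x₄) · tMid(x₁,x₃,x₄) = (1 + v² − u²)/(2v). -/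
open scoped RealInnerProductSpace Topology

noncomputable section

/-- Cosine of the angle at `m` between the circumcircles of `(a, m, b)` and `(c, m, b)`. -/
lemma inner_tMid_tMid (a c m b : E3) (ha : a ≠ m) (hc : c ≠ m) (hb : m ≠ b) :
    ⟪tMid a m b, tMid c m b⟫ =
      (dist a m ^ 2 * dist c b ^ 2 + dist c m ^ 2 * dist a b ^ 2 - dist m b ^ 2 * dist c a ^ 2) /
        (2 * dist a m * dist c m * (dist a b * dist c b)) := by
  have polar (x y : E3) : ⟪x - m, y - m⟫ = (dist x m ^ 2 + dist y m ^ 2 - dist x y ^ 2) / 2 := by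
    rw [dist_eq_norm x y, ← sub_sub_sub_cancel_right x y m, norm_sub_sq_real,
      dist_eq_norm, dist_eq_norm]
    ring
  have hma : m - a = -(a - m) := by abel
  have hmc : m - c = -(c - m) := by abel
  have hA : dist a m ≠ 0 := dist_ne_zero.2 ha
  have hC : dist c m ≠ 0 := dist_ne_zero.2 hc
  have hB : dist m b ≠ 0 := dist_ne_zero.2 hb
  simp only [tMid, hma, hmc, inner_smul_left, inner_smul_right, inner_add_left, inner_add_right,
    inner_neg_left, inner_neg_right, polar, dist_self, dist_comm b m,
    dist_comm b c, dist_comm a c, conj_trivial]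
  rw [one_div, one_div, ← div_div _ (2 * dist a m * dist c m), div_eq_mul_inv _ (dist a b * _),
    mul_inv]
  field_simp
  ring

theorem statement13 (x₁ x₂ x₃ x₄ : E3)
    (h12 : x₁ ≠ x₂) (h13 : x₁ ≠ x₃) (h14 : x₁ ≠ x₄)
    (h23 : x₂ ≠ x₃) (h24 : x₂ ≠ x₄) (h34 : x₃ ≠ x₄)
    (u v : ℝ)
    (hu : u = dist x₁ x₂ * dist x₃ x₄ / (dist x₁ x₃ * dist x₂ x₄))
    (hv : v = dist x₁ x₄ * dist x₂ x₃ / (dist x₁ x₃ * dist x₂ x₄)) :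
    ⟪tMid x₂ x₃ x₄, tMid x₁ x₃ x₄⟫ = (1 + v ^ 2 - u ^ 2) / (2 * v) := by
  have d13 : dist x₁ x₃ ≠ 0 := dist_ne_zero.2 h13
  have d14 : dist x₁ x₄ ≠ 0 := dist_ne_zero.2 h14
  have d23 : dist x₂ x₃ ≠ 0 := dist_ne_zero.2 h23
  have d24 : dist x₂ x₄ ≠ 0 := dist_ne_zero.2 h24
  rw [inner_tMid_tMid x₂ x₁ x₃ x₄ h23 h13 h34, hu, hv]
  field_simp
  ring
end
end

section
/- For four pairwise distinct points x₁, x₂, x₃, x₄ ∈ ℝ³ with cross ratios u = (x₁₂·x₃₄)/(x₁₃·x₂₄) and v = (x₁₄·x₂₃)/(x₁₃·x₂₄), the cosine of the crossing angle at x₄ between the circumcircle of (x₁,x₃,x₄) and the circumcircle of (x₁,x₂,x₄) equals q = (1 + u² − v²)/(2u); that is, tLast(x₁,x₃,x₄) · tLast(x₁,x₂,x₄) = (1 + u² − v²)/(2u). -/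
open scoped RealInnerProductSpace Topology

noncomputable section

theorem inner_sub_sub_eq_dist (a b c : E3) :
    ⟪a - c, b - c⟫ = (dist a c ^ 2 + dist b c ^ 2 - dist a b ^ 2) / 2 := by
  have h := norm_sub_sq_real (a - c) (b - c)
  rw [sub_sub_sub_cancel_right] at h
  simp only [dist_eq_norm]
  linarith

theorem statement14 (x₁ x₂ x₃ x₄ : E3)
    (h12 : x₁ ≠ x₂) (h13 : x₁ ≠ x₃) (h14 : x₁ ≠ x₄)
    (h23 : x₂ ≠ x₃) (h24 : x₂ ≠ x₄) (h34 : x₃ ≠ x₄)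
    (u v : ℝ)
    (hu : u = dist x₁ x₂ * dist x₃ x₄ / (dist x₁ x₃ * dist x₂ x₄))
    (hv : v = dist x₁ x₄ * dist x₂ x₃ / (dist x₁ x₃ * dist x₂ x₄)) :
    ⟪tLast x₁ x₃ x₄, tLast x₁ x₂ x₄⟫ = (1 + u ^ 2 - v ^ 2) / (2 * u) := by
  have p12 := (dist_pos.2 h12).ne'
  have p13 := (dist_pos.2 h13).ne'
  have p14 := (dist_pos.2 h14).ne'
  have p24 := (dist_pos.2 h24).ne'
  have p34 := (dist_pos.2 h34).ne'
  subst hu hv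
  simp only [tLast, ← neg_sub x₃ x₄, ← neg_sub x₂ x₄, inner_smul_left, inner_smul_right,
    inner_add_left, inner_add_right, inner_neg_left, inner_neg_right, smul_neg,
    inner_sub_sub_eq_dist, dist_self, dist_comm x₃ x₁, dist_comm x₃ x₂,
    RCLike.conj_to_real]
  field_simp
  ring
end
end

section
/- For four pairwise distinct points x₁, x₂, x₃, x₄ ∈ ℝ³ with cross ratios u = (x₁₂·x₃₄)/(x₁₃·x₂₄) and v = (x₁₄·x₂₃)/(x₁₃·x₂₄), the cosine of the crossing angle at x₂ between the circumcircle of (x₂,x₃,x₄) and the circumcircle of (x₁,x₂,x₄) equals r = (1 − u² − v²)/(2uv); that is, tFirst(x₂,x₃,x₄) · tMid(x₁,x₂,x₄) = (1 − u² − v²)/(2uv). -/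
open scoped RealInnerProductSpace Topology

noncomputable section

/-- Polarization: the inner product of two difference vectors in terms of pairwise distances. -/
theorem inner_sub_sub_eq_dist_sq {V : Type*} [NormedAddCommGroup V] [InnerProductSpace ℝ V]
    (a b c d : V) :
    ⟪a - b, c - d⟫ = (dist a d ^ 2 + dist b c ^ 2 - dist a c ^ 2 - dist b d ^ 2) / 2 := by
  simp only [dist_eq_norm, norm_sub_sq_real, inner_sub_left, inner_sub_right]
  ring

theorem statement15 (x₁ x₂ x₃ x₄ : E3)
    (h12 : x₁ ≠ x₂) (h13 : x₁ ≠ x₃) (h14 : x₁ ≠ x₄)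
    (h23 : x₂ ≠ x₃) (h24 : x₂ ≠ x₄) (h34 : x₃ ≠ x₄)
    (u v : ℝ)
    (hu : u = dist x₁ x₂ * dist x₃ x₄ / (dist x₁ x₃ * dist x₂ x₄))
    (hv : v = dist x₁ x₄ * dist x₂ x₃ / (dist x₁ x₃ * dist x₂ x₄)) :
    ⟪tFirst x₂ x₃ x₄, tMid x₁ x₂ x₄⟫ = (1 - u ^ 2 - v ^ 2) / (2 * u * v) := by
  have p12 := dist_ne_zero.mpr h12
  have p13 := dist_ne_zero.mpr h13
  have p14 := dist_ne_zero.mpr h14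
  have p23 := dist_ne_zero.mpr h23
  have p24 := dist_ne_zero.mpr h24
  have p34 := dist_ne_zero.mpr h34
  subst hu hv
  simp only [tFirst, tMid, inner_smul_left, inner_smul_right, inner_add_left, inner_add_right,
    inner_sub_sub_eq_dist_sq, dist_self, conj_trivial]
  rw [dist_comm x₃ x₂, dist_comm x₃ x₁, dist_comm x₂ x₁, dist_comm x₄ x₁, dist_comm x₄ x₂]
  field_simp
  ring
end
end

section
/- Let u, v be real numbers with u > 0, v > 0, u + v ≥ 1 and |u − v| ≤ 1, and set p = (1 + v² − u²)/(2v), q = (1 + u² − v²)/(2u), r = (1 − u² − v²)/(2uv). Then p² ≤ 1, q² ≤ 1 and r = p·q − √((1 − p²)(1 − q²)); in particular, writing p = cos φ, q = cos ψ, r = cos χ with φ, ψ, χ ∈ [0, π], one has cos χ = cos(φ + ψ). -/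
/-- Sixteen times the squared area of a triangle with sides `1`, `u`, `v` (Heron). -/
def heron (u v : ℝ) : ℝ :=
  (u + v + 1) * (u + v - 1) * (1 + (u - v)) * (1 - (u - v))

theorem heron_nonneg {u v : ℝ} (huv : 1 ≤ u + v) (huv' : |u - v| ≤ 1) : 0 ≤ heron u v := by
  obtain ⟨h₁, h₂⟩ := abs_le.mp huv'
  exact mul_nonneg (mul_nonneg (mul_nonneg (by linarith) (by linarith)) (by linarith))
    (by linarith)

theorem heron_comm (u v : ℝ) : heron u v = heron v u := by
  unfold heron
  ring

/-- The squared sine of the angle between the sides `1` and `v`, by the law of cosines. -/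
theorem one_sub_sq_eq_heron_div (u : ℝ) {v : ℝ} (hv : v ≠ 0) :
    1 - ((1 + v ^ 2 - u ^ 2) / (2 * v)) ^ 2 = heron u v / (2 * v) ^ 2 := by
  unfold heron
  field_simp
  ring

theorem statement17 (u v : ℝ) (hu : 0 < u) (hv : 0 < v)
    (huv : 1 ≤ u + v) (huv' : |u - v| ≤ 1)
    (p q r : ℝ)
    (hp : p = (1 + v ^ 2 - u ^ 2) / (2 * v))
    (hq : q = (1 + u ^ 2 - v ^ 2) / (2 * u))
    (hr : r = (1 - u ^ 2 - v ^ 2) / (2 * u * v)) :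
    (p ^ 2 ≤ 1 ∧ q ^ 2 ≤ 1 ∧
      r = p * q - Real.sqrt ((1 - p ^ 2) * (1 - q ^ 2))) ∧
    ∀ φ ψ χ : ℝ, φ ∈ Set.Icc 0 Real.pi → ψ ∈ Set.Icc 0 Real.pi →
      χ ∈ Set.Icc 0 Real.pi →
      p = Real.cos φ → q = Real.cos ψ → r = Real.cos χ →
      Real.cos χ = Real.cos (φ + ψ) := by
  have hΔ := heron_nonneg huv huv'
  have hp' : 1 - p ^ 2 = heron u v / (2 * v) ^ 2 := by
    rw [hp, one_sub_sq_eq_heron_div u hv.ne']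
  have hq' : 1 - q ^ 2 = heron u v / (2 * u) ^ 2 := by
    rw [hq, one_sub_sq_eq_heron_div v hu.ne', heron_comm]
  have hp_nonneg : 0 ≤ 1 - p ^ 2 := hp' ▸ by positivity
  have hq_nonneg : 0 ≤ 1 - q ^ 2 := hq' ▸ by positivity
  have hsqrt : √((1 - p ^ 2) * (1 - q ^ 2)) = heron u v / (4 * u * v) := by
    rw [hp', hq', show heron u v / (2 * v) ^ 2 * (heron u v / (2 * u) ^ 2) =
      (heron u v / (4 * u * v)) ^ 2 by field_simp; norm_num]
    exact Real.sqrt_sq (by positivity)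
  have hmain : r = p * q - √((1 - p ^ 2) * (1 - q ^ 2)) := by
    rw [hsqrt, hp, hq, hr, heron]
    field_simp
    ring
  refine ⟨⟨by linarith, by linarith, hmain⟩, ?_⟩
  intro φ ψ χ hφ hψ _ hpφ hqψ hrχ
  rw [← hrχ, hmain, Real.sqrt_mul hp_nonneg, hpφ, hqψ, Real.cos_add,
    Real.sin_eq_sqrt_one_sub_cos_sq hφ.1 hφ.2, Real.sin_eq_sqrt_one_sub_cos_sq hψ.1 hψ.2]
end

section
/- If four pairwise distinct points x₁, x₂, x₃, x₄ ∈ ℝ³ all lie on one common circle or on one common straight line, then their cross ratios u = (x₁₂·x₃₄)/(x₁₃·x₂₄) and v = (x₁₄·x₂₃)/(x₁₃·x₂₄) lie on the boundary of the admissible region: u + v = 1 or u − v = 1 or v − u = 1 (i.e. one of the Ptolemy-type inequalities holds with equality). -/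
open scoped RealInnerProductSpace

noncomputable section

/-- If three nonnegative numbers, one of them positive, satisfy the degenerate Heron equation,
then one of them is the sum of the other two. -/
lemma ptolemy_of_heron_eq_zero {a b c : ℝ} (ha : 0 ≤ a) (hb : 0 ≤ b) (hc : 0 < c)
    (h : a ^ 4 + b ^ 4 + c ^ 4 - 2 * a ^ 2 * b ^ 2 - 2 * b ^ 2 * c ^ 2 - 2 * c ^ 2 * a ^ 2 = 0) :
    a + b = c ∨ a - b = c ∨ b - a = c := by
  have hpos : a + b + c ≠ 0 := by positivity
  have hprod : (a + b + c) * ((a + b - c) * ((a - b - c) * (b - a - c))) = 0 := by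
    linear_combination -h
  simpa [hpos, sub_eq_zero] using hprod

/-- For four coplanar vectors of equal length, the products of opposite distances satisfy the
degenerate Heron equation: it says that the matrix of squared distances is singular. -/
lemma heron_eq_zero_of_norm_eq {r : ℝ} {n : E3} (hn : n ≠ 0) (y : Fin 4 → E3)
    (hr : ∀ i, ‖y i‖ = r) (hy : ∀ i, ⟪y i, n⟫ = 0) :
    (dist (y 0) (y 1) * dist (y 2) (y 3)) ^ 4 + (dist (y 0) (y 3) * dist (y 1) (y 2)) ^ 4 +
      (dist (y 0) (y 2) * dist (y 1) (y 3)) ^ 4 -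
      2 * (dist (y 0) (y 1) * dist (y 2) (y 3)) ^ 2 *
        (dist (y 0) (y 3) * dist (y 1) (y 2)) ^ 2 -
      2 * (dist (y 0) (y 3) * dist (y 1) (y 2)) ^ 2 *
        (dist (y 0) (y 2) * dist (y 1) (y 3)) ^ 2 -
      2 * (dist (y 0) (y 2) * dist (y 1) (y 3)) ^ 2 *
        (dist (y 0) (y 1) * dist (y 2) (y 3)) ^ 2 = 0 := by
  let M : Matrix (Fin 4) (Fin 4) ℝ := .of fun i => Fin.cons 1 (y i)
  let K : Matrix (Fin 4) (Fin 4) ℝ := .of fun k j =>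
    (Fin.cons (2 * r ^ 2) (fun l : Fin 3 => -2 * y j l) : Fin 4 → ℝ) k
  let D : Matrix (Fin 4) (Fin 4) ℝ := .of fun i j => dist (y i) (y j) ^ 2
  have hM : M.det = 0 := by
    refine Matrix.exists_mulVec_eq_zero_iff.mp ⟨Fin.cons 0 n, ?_, ?_⟩
    · intro h
      apply hn
      ext l
      simpa using congrFun h l.succ
    · ext i
      have := hy i
      simp only [PiLp.inner_apply, RCLike.inner_apply, conj_trivial] at this
      simp [M, Matrix.mulVec, dotProduct, Fin.sum_univ_succ (n := 3), ← this, mul_comm]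
  have hD : D = M * K := by
    ext i j
    have hinner : ⟪y i, y j⟫ = ∑ l, y i l * y j l := by
      simp [PiLp.inner_apply, mul_comm]
    have hdist : dist (y i) (y j) ^ 2 = 2 * r ^ 2 - 2 * ⟪y i, y j⟫ := by
      rw [dist_eq_norm, norm_sub_sq_real, hr, hr]; ring
    simp only [D, M, K, Matrix.mul_apply, Matrix.of_apply, hdist, hinner,
      Fin.sum_univ_succ (n := 3), Fin.cons_zero, Fin.cons_succ, Fin.sum_univ_three]
    ring
  have hdet : D.det = 0 := by rw [hD, Matrix.det_mul, hM, zero_mul]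
  have h10 := dist_comm (y 1) (y 0)
  have h20 := dist_comm (y 2) (y 0)
  have h30 := dist_comm (y 3) (y 0)
  have h21 := dist_comm (y 2) (y 1)
  have h31 := dist_comm (y 3) (y 1)
  have h32 := dist_comm (y 3) (y 2)
  simp [D, Matrix.det_succ_row_zero, Fin.sum_univ_succ, Fin.succAbove, h10, h20, h30, h21, h31,
    h32] at hdet
  linear_combination hdet

/-- Ptolemy's equality, up to the order of the points, for four points on a circle or a line. -/
lemma ptolemy_of_circle_or_line {x₁ x₂ x₃ x₄ : E3} (h13 : x₁ ≠ x₃) (h24 : x₂ ≠ x₄)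
    (hcc : (∃ (c : E3) (ρ : ℝ) (n : E3), 0 < ρ ∧ n ≠ 0 ∧
        ∀ y ∈ ({x₁, x₂, x₃, x₄} : Set E3), dist y c = ρ ∧ ⟪y - c, n⟫ = 0) ∨
      ∃ (a d : E3), d ≠ 0 ∧ ∀ y ∈ ({x₁, x₂, x₃, x₄} : Set E3), ∃ t : ℝ, y = a + t • d) :
    dist x₁ x₂ * dist x₃ x₄ + dist x₁ x₄ * dist x₂ x₃ = dist x₁ x₃ * dist x₂ x₄ ∨
    dist x₁ x₂ * dist x₃ x₄ - dist x₁ x₄ * dist x₂ x₃ = dist x₁ x₃ * dist x₂ x₄ ∨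
    dist x₁ x₄ * dist x₂ x₃ - dist x₁ x₂ * dist x₃ x₄ = dist x₁ x₃ * dist x₂ x₄ := by
  refine ptolemy_of_heron_eq_zero (by positivity) (by positivity)
    (mul_pos (dist_pos.mpr h13) (dist_pos.mpr h24)) ?_
  rcases hcc with ⟨c, ρ, n, -, hn, h⟩ | ⟨a, d, -, h⟩
  · simp only [Set.mem_insert_iff, Set.mem_singleton_iff, forall_eq_or_imp, forall_eq] at h
    obtain ⟨⟨h1, k1⟩, ⟨h2, k2⟩, ⟨h3, k3⟩, h4, k4⟩ := h
    rw [dist_eq_norm] at h1 h2 h3 h4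
    simpa using heron_eq_zero_of_norm_eq (r := ρ) hn ![x₁ - c, x₂ - c, x₃ - c, x₄ - c]
      (by simp [Fin.forall_fin_succ, *]) (by simp [Fin.forall_fin_succ, *])
  · simp only [Set.mem_insert_iff, Set.mem_singleton_iff, forall_eq_or_imp, forall_eq] at h
    obtain ⟨⟨s, rfl⟩, ⟨t, rfl⟩, ⟨p, rfl⟩, q, rfl⟩ := h
    have hdist (s t : ℝ) : dist (a + s • d) (a + t • d) = |s - t| * ‖d‖ := by
      rw [dist_add_left, dist_eq_norm, ← sub_smul, norm_smul, Real.norm_eq_abs]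
    have habs (s : ℝ) : |s| ^ 4 = s ^ 4 := Even.pow_abs (by decide) s
    simp only [hdist, mul_pow, sq_abs, habs]
    ring

theorem statement19 (x₁ x₂ x₃ x₄ : E3)
    (h12 : x₁ ≠ x₂) (h13 : x₁ ≠ x₃) (h14 : x₁ ≠ x₄)
    (h23 : x₂ ≠ x₃) (h24 : x₂ ≠ x₄) (h34 : x₃ ≠ x₄)
    -- the four points lie on one common circle (sphere ∩ plane through its center)
    -- or on one common straight line
    (hcc : (∃ (c : E3) (ρ : ℝ) (n : E3), 0 < ρ ∧ n ≠ 0 ∧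
        ∀ y ∈ ({x₁, x₂, x₃, x₄} : Set E3), dist y c = ρ ∧ ⟪y - c, n⟫ = 0) ∨
      ∃ (a d : E3), d ≠ 0 ∧ ∀ y ∈ ({x₁, x₂, x₃, x₄} : Set E3), ∃ t : ℝ, y = a + t • d)
    (u v : ℝ)
    (hu : u = dist x₁ x₂ * dist x₃ x₄ / (dist x₁ x₃ * dist x₂ x₄))
    (hv : v = dist x₁ x₄ * dist x₂ x₃ / (dist x₁ x₃ * dist x₂ x₄)) :
    u + v = 1 ∨ u - v = 1 ∨ v - u = 1 := by
  have hc : dist x₁ x₃ * dist x₂ x₄ ≠ 0 :=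
    mul_ne_zero (dist_ne_zero.mpr h13) (dist_ne_zero.mpr h24)
  rw [hu, hv, ← add_div, ← sub_div, ← sub_div, div_eq_one_iff_eq hc, div_eq_one_iff_eq hc,
    div_eq_one_iff_eq hc]
  exact ptolemy_of_circle_or_line h13 h24 hcc
end
end
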